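/- arXiv:2508.11448 — 5 statements merged into one kernel-verified Lean document; each statement's English description precedes it below -/
import Mathlib

section
/- Let V be an irreducible cuspidal Harish-Chandra module over τ(B). Then 𝒦(B) = 𝒦 ⊗ B acts trivially on V: (t^m K_i ⊗ a)·v = 0 for all m ∈ ℤ^n, 1 ≤ i ≤ n, a ∈ B, v ∈ V. -/
open scoped TensorProduct

namespace MT

/-- Presentation of the full toroidal Lie algebra `τ` of rank `n` associated with the
finite-dimensional simple complex Lie algebra `𝔤`, the invariant form `κ` and the
2-cocycle `φ = c₁ • φ₁ + c₂ • φ₂`.  Here `E m x` stands for `x ⊗ t^m`, `K m i` for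
`t^m K_i` (the image in the space of Kähler differentials `𝒦 = Ω/dA_n`), and
`W m i` for `t^m d_i`. -/
structure IsFullToroidal (n : ℕ) (𝔤 : Type) [LieRing 𝔤] [LieAlgebra ℂ 𝔤]
    (τ : Type) [LieRing τ] [LieAlgebra ℂ τ]
    (κ : 𝔤 →ₗ[ℂ] 𝔤 →ₗ[ℂ] ℂ) (c₁ c₂ : ℂ)
    (E : (Fin n → ℤ) → 𝔤 →ₗ[ℂ] τ) (K W : (Fin n → ℤ) → Fin n → τ) : Prop where
  κ_symm : ∀ x y, κ x y = κ y x
  κ_invariant : ∀ x y z, κ ⁅x, y⁆ z = κ x ⁅y, z⁆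
  κ_nondeg : ∀ x, (∀ y, κ x y = 0) → x = 0
  span_eq_top : Submodule.span ℂ
      ({z : τ | ∃ m x, z = E m x} ∪ {z : τ | ∃ m i, z = K m i} ∪
        {z : τ | ∃ m i, z = W m i}) = ⊤
  K_rel : ∀ m : Fin n → ℤ, (∑ i, (m i : ℂ) • K m i) = 0
  lie_E_E : ∀ m k x y, ⁅E m x, E k y⁆
      = E (m + k) ⁅x, y⁆ + κ x y • ∑ i, (m i : ℂ) • K (m + k) i
  lie_E_K : ∀ m x k j, ⁅E m x, K k j⁆ = 0
  lie_K_K : ∀ m i k j, ⁅K m i, K k j⁆ = 0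
  lie_W_E : ∀ m i k x, ⁅W m i, E k x⁆ = (k i : ℂ) • E (m + k) x
  lie_W_K : ∀ m i k j, ⁅W m i, K k j⁆
      = (k i : ℂ) • K (m + k) j + (if i = j then ∑ p, (m p : ℂ) • K (m + k) p else 0)
  lie_W_W : ∀ m i k j, ⁅W m i, W k j⁆
      = (k i : ℂ) • W (m + k) j - (m j : ℂ) • W (m + k) i
        + (c₁ * (-((k i : ℂ) * (m j : ℂ))) + c₂ * ((m i : ℂ) * (k j : ℂ)))
          • ∑ p, (m p : ℂ) • K (m + k) p

/-- The map algebra `τ(B) = τ ⊗ B` is a complex Lie algebra. -/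
noncomputable instance mapLieAlgebra (B τ : Type) [CommRing B] [Algebra ℂ B]
    [LieRing τ] [LieAlgebra ℂ τ] : LieAlgebra ℂ (B ⊗[ℂ] τ) :=
  { (inferInstance : Module ℂ (B ⊗[ℂ] τ)) with
    lie_smul := fun c x y => by
      rw [← algebraMap_smul B c y, lie_smul, algebraMap_smul] }

/-- The simultaneous eigenspace ("weight space") of the commuting family of
operators `d` for the eigenvalue function `l`. -/
def weightSpace {n : ℕ} {L V : Type*} [LieRing L] [LieAlgebra ℂ L] [AddCommGroup V]
    [Module ℂ V] [LieRingModule L V] [LieModule ℂ L V]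
    (d : Fin n → L) (l : Fin n → ℂ) : Submodule ℂ V where
  carrier := {v | ∀ i, ⁅d i, v⁆ = l i • v}
  add_mem' := by
    intro a b ha hb i
    rw [lie_add, ha i, hb i, smul_add]
  zero_mem' := by
    intro i
    rw [lie_zero, smul_zero]
  smul_mem' := by
    intro c a ha i
    rw [lie_smul, ha i, smul_comm]

/-- `V` is a Harish-Chandra module with respect to the degree operators `d`:
the sum of the weight spaces is all of `V` and each weight space is finite
dimensional. -/
def IsHarishChandra {n : ℕ} {L V : Type*} [LieRing L] [LieAlgebra ℂ L] [AddCommGroup V]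
    [Module ℂ V] [LieRingModule L V] [LieModule ℂ L V] (d : Fin n → L) : Prop :=
  (⨆ l : Fin n → ℂ, weightSpace (V := V) d l) = ⊤ ∧
    ∀ l : Fin n → ℂ, FiniteDimensional ℂ (weightSpace (V := V) d l)

/-- `V` is cuspidal (uniformly bounded): a Harish-Chandra module whose weight
space dimensions admit a uniform bound. -/
def IsCuspidal {n : ℕ} {L V : Type*} [LieRing L] [LieAlgebra ℂ L] [AddCommGroup V]
    [Module ℂ V] [LieRingModule L V] [LieModule ℂ L V] (d : Fin n → L) : Prop :=
  IsHarishChandra (V := V) d ∧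
    ∃ N : ℕ, ∀ l : Fin n → ℂ, Module.finrank ℂ (weightSpace (V := V) d l) ≤ N

/-- The degree operators `d_i ⊗ 1` inside `τ(B)`. -/
noncomputable def dOp {n : ℕ} (B : Type) [CommRing B] [Algebra ℂ B] {τ : Type}
    [LieRing τ] [LieAlgebra ℂ τ] (W : (Fin n → ℤ) → Fin n → τ) (i : Fin n) :
    B ⊗[ℂ] τ :=
  (1 : B) ⊗ₜ[ℂ] W 0 i

variable {n : ℕ} {𝔤 : Type} [LieRing 𝔤] [LieAlgebra ℂ 𝔤]
variable {τ : Type} [LieRing τ] [LieAlgebra ℂ τ]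

/-- The set of homogeneous generators of `τ` of degree `m`. -/
def genOfDeg (E : (Fin n → ℤ) → 𝔤 →ₗ[ℂ] τ) (K W : (Fin n → ℤ) → Fin n → τ)
    (m : Fin n → ℤ) : Set τ :=
  Set.range (E m) ∪ Set.range (K m) ∪ Set.range (W m)

/-- The homogeneous generators of `τ` of degree lying in the subgroup `M`,
i.e. generators of `τ_M`. -/
def tauMGens (E : (Fin n → ℤ) → 𝔤 →ₗ[ℂ] τ) (K W : (Fin n → ℤ) → Fin n → τ)
    (M : AddSubgroup (Fin n → ℤ)) : Set τ :=
  {Y | ∃ m ∈ M, Y ∈ genOfDeg E K W m}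

/-- The graded piece `τ_m`. -/
def gradedPiece (E : (Fin n → ℤ) → 𝔤 →ₗ[ℂ] τ) (K W : (Fin n → ℤ) → Fin n → τ)
    (m : Fin n → ℤ) : Submodule ℂ τ :=
  Submodule.span ℂ (genOfDeg E K W m)

/-- The subalgebra `τ(B)_M = ⊕_{m ∈ M} τ_m ⊗ B` of `τ(B)`. -/
noncomputable def tauBM (B : Type) [CommRing B] [Algebra ℂ B]
    (E : (Fin n → ℤ) → 𝔤 →ₗ[ℂ] τ) (K W : (Fin n → ℤ) → Fin n → τ)
    (M : AddSubgroup (Fin n → ℤ)) : LieSubalgebra ℂ (B ⊗[ℂ] τ) :=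
  LieSubalgebra.lieSpan ℂ (B ⊗[ℂ] τ)
    {z | ∃ (a : B) (Y : τ), Y ∈ tauMGens E K W M ∧ z = a ⊗ₜ[ℂ] Y}

/-- The degree operators `d_i ⊗ 1` as elements of `τ(B)_M` (note `0 ∈ M`). -/
noncomputable def dOpM (B : Type) [CommRing B] [Algebra ℂ B]
    (E : (Fin n → ℤ) → 𝔤 →ₗ[ℂ] τ) (K W : (Fin n → ℤ) → Fin n → τ)
    (M : AddSubgroup (Fin n → ℤ)) (i : Fin n) : ↥(tauBM B E K W M) :=
  ⟨(1 : B) ⊗ₜ[ℂ] W 0 i,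
    LieSubalgebra.subset_lieSpan
      ⟨1, W 0 i, ⟨0, M.zero_mem, Or.inr ⟨i, rfl⟩⟩, rfl⟩⟩

/-- `(τ ⊗ I)·V = 0`. -/
def annTensor (τ : Type) [LieRing τ] [LieAlgebra ℂ τ] (B : Type) [CommRing B]
    [Algebra ℂ B] (I : Ideal B) (V : Type) [AddCommGroup V] [Module ℂ V]
    [LieRingModule (B ⊗[ℂ] τ) V] : Prop :=
  ∀ X : τ, ∀ a ∈ I, ∀ v : V, ⁅a ⊗ₜ[ℂ] X, v⁆ = 0

/-- The action of `τ(B)` on `V` is by evaluation at the algebra homomorphism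
`ψ : B → ℂ`:  `(X ⊗ b)·v = ψ(b) (X ⊗ 1)·v`. -/
def evalActs (τ : Type) [LieRing τ] [LieAlgebra ℂ τ] (B : Type) [CommRing B]
    [Algebra ℂ B] (ψ : B →ₐ[ℂ] ℂ) (V : Type) [AddCommGroup V] [Module ℂ V]
    [LieRingModule (B ⊗[ℂ] τ) V] : Prop :=
  ∀ (X : τ) (b : B) (v : V), ⁅b ⊗ₜ[ℂ] X, v⁆ = ψ b • ⁅(1 : B) ⊗ₜ[ℂ] X, v⁆

/-- `v` is annihilated by `τ(B)^+_M = ⊕_{m ∈ M, r ≥ 1} τ(B)_{m + rβ}`. -/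
def annPlus (B : Type) [CommRing B] [Algebra ℂ B]
    (E : (Fin n → ℤ) → 𝔤 →ₗ[ℂ] τ) (K W : (Fin n → ℤ) → Fin n → τ)
    (M : AddSubgroup (Fin n → ℤ)) (β : Fin n → ℤ) {V : Type} [AddCommGroup V]
    [Module ℂ V] [LieRingModule (B ⊗[ℂ] τ) V] (v : V) : Prop :=
  ∀ m₀ ∈ M, ∀ r : ℕ, 0 < r → ∀ a : B,
    (∀ x : 𝔤, ⁅a ⊗ₜ[ℂ] E (m₀ + (r : ℤ) • β) x, v⁆ = 0) ∧
    (∀ i : Fin n, ⁅a ⊗ₜ[ℂ] K (m₀ + (r : ℤ) • β) i, v⁆ = 0) ∧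
    (∀ i : Fin n, ⁅a ⊗ₜ[ℂ] W (m₀ + (r : ℤ) • β) i, v⁆ = 0)

/-- Successive action of a list of Lie algebra elements on a module vector:
`actList [x₁, …, x_r] v = x₁ · (x₂ ⋯ (x_r · v))`. -/
def actList {L V : Type*} [LieRing L] [AddCommGroup V] [LieRingModule L V] :
    List L → V → V
  | [], v => v
  | x :: xs, v => ⁅x, actList xs v⁆

/-- `V` is a highest weight module for `τ(B)`:  there are `M ≤ ℤⁿ` and `β ∈ ℤⁿ`
with `ℤⁿ = M ⊕ ℤβ` and a nonzero `v ∈ V` with `τ(B)^+_M · v = 0` which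
generates `V` over `U(τ(B))`. -/
def IsHighestWeightModule (B : Type) [CommRing B] [Algebra ℂ B]
    (E : (Fin n → ℤ) → 𝔤 →ₗ[ℂ] τ) (K W : (Fin n → ℤ) → Fin n → τ)
    (V : Type) [AddCommGroup V] [Module ℂ V] [LieRingModule (B ⊗[ℂ] τ) V]
    [LieModule ℂ (B ⊗[ℂ] τ) V] : Prop :=
  ∃ (M : AddSubgroup (Fin n → ℤ)) (β : Fin n → ℤ),
    IsCompl M (AddSubgroup.zmultiples β) ∧
    ∃ v : V, v ≠ 0 ∧ annPlus B E K W M β v ∧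
      LieSubmodule.lieSpan ℂ (B ⊗[ℂ] τ) {v} = ⊤

/-- Linear independence properties of the generators of the full toroidal Lie
algebra: the only linear relations among the homogeneous generators are the
Kähler relations `∑ᵢ mᵢ t^m K_i = 0`. -/
structure FreeGens (E : (Fin n → ℤ) → 𝔤 →ₗ[ℂ] τ) (K W : (Fin n → ℤ) → Fin n → τ) :
    Prop where
  K_indep : ∀ (m : Fin n → ℤ) (c : Fin n → ℂ), (∑ i, c i • K m i) = 0 →
      ∃ t : ℂ, ∀ i, c i = t * (m i : ℂ)
  W_indep : ∀ (m : Fin n → ℤ) (c : Fin n → ℂ), (∑ i, c i • W m i) = 0 → ∀ i, c i = 0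
  E_inj : ∀ (m : Fin n → ℤ) (x : 𝔤), E m x = 0 → x = 0
  EKW_indep : ∀ (m : Fin n → ℤ) (x : 𝔤) (c d : Fin n → ℂ),
      E m x + (∑ i, c i • K m i) + (∑ i, d i • W m i) = 0 →
      x = 0 ∧ (∀ i, d i = 0) ∧ ∃ t : ℂ, ∀ i, c i = t * (m i : ℂ)
  graded_indep : ∀ m : Fin n → ℤ,
      gradedPiece E K W m ⊓ (⨆ k : Fin n → ℤ, ⨆ _ : k ≠ m, gradedPiece E K W k) = ⊥

section LinearAlgebra

variable {V Λ : Type*} [AddCommGroup V] [Module ℂ V] [AddCommGroup Λ]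

/-- `f` maps the weight space of weight `μ` to that of weight `μ + d`. -/
def HasDeg (P : Λ → Submodule ℂ V) (f : Module.End ℂ V) (d : Λ) : Prop :=
  ∀ μ, ∀ v ∈ P μ, f v ∈ P (μ + d)

lemma HasDeg.mul {P : Λ → Submodule ℂ V} {f g : Module.End ℂ V} {d e : Λ}
    (hf : HasDeg P f d) (hg : HasDeg P g e) : HasDeg P (f * g) (e + d) := by
  intro μ v hv
  have := hf _ _ (hg μ v hv)
  rwa [add_assoc] at this

/-- `z` is locally nilpotent. -/
def LocNil (z : Module.End ℂ V) : Prop := ∀ v, ∃ p : ℕ, (z ^ p) v = 0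

/-- A large family of operators mapping boundedly many spaces of bounded dimension into spaces of
bounded dimension is linearly dependent on these spaces. -/
lemma exists_relation {ι J : Type*} [Fintype ι] [Fintype J] (P Q : J → Submodule ℂ V) (N : ℕ)
    [∀ j, FiniteDimensional ℂ (P j)] [∀ j, FiniteDimensional ℂ (Q j)]
    (hP : ∀ j, Module.finrank ℂ (P j) ≤ N) (hQ : ∀ j, Module.finrank ℂ (Q j) ≤ N)
    (f : ι → Module.End ℂ V) (hf : ∀ i j, ∀ v ∈ P j, f i v ∈ Q j)
    (hcard : Fintype.card J * (N * N) < Fintype.card ι) :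
    ∃ c : ι → ℂ, c ≠ 0 ∧ ∀ j, ∀ v ∈ P j, (∑ i, c i • f i) v = 0 := by
  let F : (ι → ℂ) →ₗ[ℂ] (∀ j, P j →ₗ[ℂ] Q j) :=
    Fintype.linearCombination ℂ (fun i j => (f i).restrict (hf i j))
  have hker : LinearMap.ker F ≠ ⊥ := by
    apply LinearMap.ker_ne_bot_of_finrank_lt
    rw [Module.finrank_pi_fintype, Module.finrank_fintype_fun_eq_card]
    refine lt_of_le_of_lt ?_ hcard
    calc ∑ j, Module.finrank ℂ (P j →ₗ[ℂ] Q j) ≤ ∑ _j : J, N * N := by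
          apply Finset.sum_le_sum
          intro j _
          rw [Module.finrank_linearMap]
          exact Nat.mul_le_mul (hP j) (hQ j)
      _ = _ := by simp
  obtain ⟨c, hc, hc0⟩ := Submodule.exists_mem_ne_zero_of_ne_bot hker
  refine ⟨c, hc0, fun j v hv => ?_⟩
  have h1 : F c j ⟨v, hv⟩ = 0 := by
    rw [LinearMap.mem_ker.1 hc]; rfl
  have h2 := congrArg (Q j).subtype h1
  simpa [F, Fintype.linearCombination_apply, LinearMap.sum_apply] using h2

/-- A set of commuting locally nilpotent operators whose values at `v` span a finite-dimensional
space has a common kernel vector that is a monomial applied to `v`. -/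
lemma exists_common_kernel (S : Set (Module.End ℂ V)) (hcomm : ∀ z ∈ S, ∀ z' ∈ S, Commute z z')
    (hnil : ∀ z ∈ S, LocNil z) : ∀ (d : ℕ) (v : V), v ≠ 0 →
    FiniteDimensional ℂ (Submodule.span ℂ ((fun z : Module.End ℂ V => z v) '' S)) →
    Module.finrank ℂ (Submodule.span ℂ ((fun z : Module.End ℂ V => z v) '' S)) ≤ d →
    ∃ g ∈ Submonoid.closure S, g v ≠ 0 ∧ ∀ z ∈ S, z (g v) = 0 := by
  intro d
  induction d with
  | zero =>
    intro v hv hfin hd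
    refine ⟨1, one_mem _, by simpa using hv, fun z hz => ?_⟩
    have h0 : Submodule.span ℂ ((fun z : Module.End ℂ V => z v) '' S) = ⊥ :=
      Submodule.finrank_eq_zero.1 (Nat.le_zero.1 hd)
    have : z v ∈ Submodule.span ℂ ((fun z : Module.End ℂ V => z v) '' S) :=
      Submodule.subset_span ⟨z, hz, rfl⟩
    rw [h0] at this
    simpa using this
  | succ d ih =>
    intro v hv hfin hd
    by_cases hall : ∀ z ∈ S, z v = 0
    · exact ⟨1, one_mem _, by simpa using hv, by simpa using hall⟩
    push Not at hall
    obtain ⟨z, hz, hzv⟩ := hall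
    classical
    have hex := hnil z hz v
    have hp := Nat.find_spec hex
    set p := Nat.find hex with hpdef
    have hp0 : p ≠ 0 := by
      intro h
      rw [h] at hp
      exact hv (by simpa using hp)
    obtain ⟨q, hq⟩ := Nat.exists_eq_succ_of_ne_zero hp0
    have hq1 : (z ^ q) v ≠ 0 := Nat.find_min hex (by omega)
    have himg : Submodule.span ℂ ((fun y : Module.End ℂ V => y ((z ^ q) v)) '' S) =
        (Submodule.span ℂ ((fun y : Module.End ℂ V => y v) '' S)).map (z ^ q) := by
      rw [Submodule.map_span, ← Set.image_comp]
      congr 1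
      apply Set.image_congr
      intro y hy
      have hc : Commute y (z ^ q) := (hcomm y hy z hz).pow_right q
      change (y * z ^ q) v = (z ^ q * y) v
      rw [hc.eq]
    have hfin' : FiniteDimensional ℂ
        (Submodule.span ℂ ((fun y : Module.End ℂ V => y ((z ^ q) v)) '' S)) := by
      rw [himg]; infer_instance
    obtain ⟨g, hg, hg1, hg2⟩ := ih ((z ^ q) v) hq1 hfin' (by
      rw [himg]
      set D := Submodule.span ℂ ((fun y : Module.End ℂ V => y v) '' S)
      have h1 := LinearMap.finrank_range_add_finrank_ker ((z ^ q).domRestrict D)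
      rw [LinearMap.range_domRestrict] at h1
      have h2 : 0 < Module.finrank ℂ (LinearMap.ker ((z ^ q).domRestrict D)) := by
        apply Module.finrank_pos_iff_exists_ne_zero.2
        refine ⟨⟨⟨z v, Submodule.subset_span ⟨z, hz, rfl⟩⟩, ?_⟩, ?_⟩
        · rw [LinearMap.mem_ker, LinearMap.domRestrict_apply]
          change (z ^ q * z) v = 0
          rw [← pow_succ]
          rw [hq] at hp
          exact hp
        · intro h
          exact hzv (congrArg Subtype.val (congrArg Subtype.val h))
      omega)
    exact ⟨g * z ^ q, mul_mem hg (pow_mem (Submonoid.subset_closure hz) q), hg1, hg2⟩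

end LinearAlgebra

section TripleProducts

/-- The six arrangements of a triple. -/
def arrange (t : Fin 6) (a b c : ℕ) : Fin 3 → ℕ :=
  match t with
  | 0 => ![a, b, c]
  | 1 => ![a, c, b]
  | 2 => ![b, a, c]
  | 3 => ![b, c, a]
  | 4 => ![c, a, b]
  | 5 => ![c, b, a]

/-- The arrangements of the strictly increasing triple `(a, M + b, 5 M - a - b)`. -/
def triple (M : ℕ) (q : (Fin M × Fin M) × Fin 6) : Fin 3 → ℕ :=
  arrange q.2 q.1.1 (M + q.1.2) (5 * M - q.1.1 - q.1.2)

lemma triple_sum (M : ℕ) (q : (Fin M × Fin M) × Fin 6) :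
    triple M q 0 + triple M q 1 + triple M q 2 = 6 * M := by
  obtain ⟨⟨a, b⟩, t⟩ := q
  have ha := a.2
  have hb := b.2
  fin_cases t <;> simp [triple, arrange] <;> omega

lemma triple_le (M : ℕ) (q : (Fin M × Fin M) × Fin 6) (j : Fin 3) : triple M q j ≤ 6 * M := by
  have := triple_sum M q
  fin_cases j <;> simp <;> omega

lemma triple_inj (M : ℕ) (q q' : (Fin M × Fin M) × Fin 6) (h0 : triple M q 0 = triple M q' 0)
    (h1 : triple M q 1 = triple M q' 1) : q = q' := by
  have h2 : triple M q 2 = triple M q' 2 := by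
    have := triple_sum M q
    have := triple_sum M q'
    omega
  obtain ⟨⟨⟨a, ha⟩, ⟨b, hb⟩⟩, t⟩ := q
  obtain ⟨⟨⟨a', ha'⟩, ⟨b', hb'⟩⟩, t'⟩ := q'
  simp only [Prod.mk.injEq, Fin.mk.injEq]
  fin_cases t <;> fin_cases t' <;> simp [triple, arrange] at h0 h1 h2 ⊢ <;> omega

/-- The inner derivation `a ↦ y a - a y`. -/
noncomputable def innerDer {R : Type*} [Ring R] [Algebra ℂ R] (y : R) : R →ₗ[ℂ] R :=
  LinearMap.mulLeft ℂ y - LinearMap.mulRight ℂ y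

lemma innerDer_apply {R : Type*} [Ring R] [Algebra ℂ R] (y a : R) :
    innerDer y a = y * a - a * y := rfl

lemma innerDer_mul {R : Type*} [Ring R] [Algebra ℂ R] (y a b : R) :
    innerDer y (a * b) = innerDer y a * b + a * innerDer y b := by
  simp only [innerDer_apply]
  noncomm_ring

lemma triple_commutator {R : Type*} [Ring R] [Algebra ℂ R] (x : ℕ → R) (y : Fin 3 → R)
    (z : Fin 3 → ℕ → R)
    (hxy : ∀ j k, innerDer (y j) (x k) = z j k) (hyz : ∀ i j k, innerDer (y i) (z j k) = 0)
    (hzz : ∀ i j k l, Commute (z i k) (z j l)) (a b c : ℕ) :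
    innerDer (y 0) (innerDer (y 1) (innerDer (y 2) (x a * x b * x c))) =
      ∑ t : Fin 6, z 0 (arrange t a b c 0) * z 1 (arrange t a b c 1) *
        z 2 (arrange t a b c 2) := by
  have e10 : ∀ k l, z 1 k * z 0 l = z 0 l * z 1 k := fun k l => hzz 1 0 k l
  have e20 : ∀ k l, z 2 k * z 0 l = z 0 l * z 2 k := fun k l => hzz 2 0 k l
  have e21 : ∀ k l, z 2 k * z 1 l = z 1 l * z 2 k := fun k l => hzz 2 1 k l
  have f10 : ∀ k l w, z 1 k * (z 0 l * w) = z 0 l * (z 1 k * w) := fun k l w => by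
    rw [← mul_assoc, e10, mul_assoc]
  simp only [innerDer_mul, map_add, hxy, hyz, zero_mul, mul_zero, add_zero, zero_add, add_mul]
  simp [Fin.sum_univ_six, arrange, mul_assoc, e10, e20, e21, f10]
  abel

variable {V Λ : Type*} [AddCommGroup V] [Module ℂ V] [AddCommGroup Λ]

/-- On a space with weight spaces of bounded dimension, operators `x k` of degrees in arithmetic
progression force a relation, with coefficients independent of the operators `y`, between triple
products of the commutators `[y, x k]`. -/
lemma exists_triple_relation (P : Λ → Submodule ℂ V) (N M : ℕ) (hM : M = 56 * (N * N) + 1)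
    (hfin : ∀ μ, FiniteDimensional ℂ (P μ)) (hN : ∀ μ, Module.finrank ℂ (P μ) ≤ N)
    (x : ℕ → Module.End ℂ V) (w r : Λ) (hx : ∀ k, HasDeg P (x k) (w + k • r)) (lam : Λ)
    (σ : Fin 3 → Λ) :
    ∃ c : Fin M × Fin M → ℂ, c ≠ 0 ∧
      ∀ (l : Fin 3 → ℕ) (y : Fin 3 → Module.End ℂ V) (z : Fin 3 → ℕ → Module.End ℂ V),
        l 0 + l 1 + l 2 = 6 * M → (∀ j, HasDeg P (y j) (σ j - l j • r)) →
        (∀ j k, innerDer (y j) (x k) = z j k) → (∀ i j k, innerDer (y i) (z j k) = 0) →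
        (∀ i j k l, Commute (z i k) (z j l)) → ∀ v ∈ P lam,
        ∑ q : (Fin M × Fin M) × Fin 6, c q.1 •
          (z 0 (triple M q 0) * z 1 (triple M q 1) * z 2 (triple M q 2)) v = 0 := by
  let base : Finset (Fin 3) × Fin (6 * M + 1) → Λ := fun j => lam + ∑ i ∈ j.1, σ i - j.2.1 • r
  obtain ⟨c, hc0, hc⟩ := exists_relation (fun j => P (base j))
    (fun j => P (base j + (3 • w + (6 * M) • r))) N (fun j => hN _) (fun j => hN _)
    (fun q : Fin M × Fin M => x q.1 * x (M + q.2) * x (5 * M - q.1 - q.2)) (by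
      rintro ⟨a, b⟩ j v hv
      have := ((hx a).mul (hx (M + b))).mul (hx (5 * M - a - b)) _ v hv
      convert this using 2
      congr 1
      have hs : 6 * M = (5 * M - a - b) + (M + b) + a := by
        have := a.2
        have := b.2
        omega
      rw [hs]
      simp only [add_smul]
      abel) (by
      simp only [Fintype.card_prod, Fintype.card_finset, Fintype.card_fin]
      have h1 : 2 ^ 3 * (6 * M + 1) * (N * N) ≤ 56 * (N * N) * M := by
        have : 1 ≤ M := by omega
        nlinarith [Nat.zero_le (N * N)]
      have h2 : 56 * (N * N) * M < M * M := by
        apply Nat.mul_lt_mul_of_pos_right <;> omega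
      omega)
  refine ⟨c, hc0, fun l y z hl hy hxy hyz hzz v hv => ?_⟩
  set T : Module.End ℂ V :=
    ∑ q : Fin M × Fin M, c q • (x q.1 * x (M + q.2) * x (5 * M - q.1 - q.2)) with hT
  have hkill : ∀ (A : Finset (Fin 3)) (k : ℕ), k ≤ 6 * M → ∀ μ, μ = lam + ∑ i ∈ A, σ i - k • r →
      ∀ u ∈ P μ, T u = 0 := by
    rintro A k hk μ rfl u hu
    exact hc (A, ⟨k, by omega⟩) u hu
  have hcomm : innerDer (y 0) (innerDer (y 1) (innerDer (y 2) T)) v = 0 := by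
    have y0 := hy 0 _ v hv
    have y1 := hy 1 _ v hv
    have y2 := hy 2 _ v hv
    have y10 := hy 1 _ _ y0
    have y20 := hy 2 _ _ y0
    have y21 := hy 2 _ _ y1
    have y210 := hy 2 _ _ y10
    have t : T v = 0 := hkill ∅ 0 (by omega) _ (by simp) v hv
    have t0 := hkill {0} (l 0) (by omega) _ (by simp; abel) _ y0
    have t1 := hkill {1} (l 1) (by omega) _ (by simp; abel) _ y1
    have t2 := hkill {2} (l 2) (by omega) _ (by simp; abel) _ y2
    have t10 := hkill {0, 1} (l 0 + l 1) (by omega) _ (by simp [add_smul]; abel) _ y10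
    have t20 := hkill {0, 2} (l 0 + l 2) (by omega) _ (by simp [add_smul]; abel) _ y20
    have t21 := hkill {1, 2} (l 1 + l 2) (by omega) _ (by simp [add_smul]; abel) _ y21
    have t210 := hkill Finset.univ (l 0 + l 1 + l 2) (by omega) _
      (by simp [add_smul, Fin.sum_univ_three]; abel) _ y210
    simp [innerDer_apply, t, t0, t1, t2, t10, t20, t21, t210]
  rw [hT] at hcomm
  simp only [map_sum, map_smul] at hcomm
  simp only [triple_commutator x y z hxy hyz hzz] at hcomm
  rw [Fintype.sum_prod_type]
  rw [← hcomm]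
  simp [LinearMap.sum_apply, triple, Finset.smul_sum]

end TripleProducts

section HeisenbergArgument

variable {V Λ : Type*} [AddCommGroup V] [Module ℂ V] [AddCommGroup Λ]

lemma exists_max_finrank (P : Λ → Submodule ℂ V) (N : ℕ)
    (hN : ∀ μ, Module.finrank ℂ (P μ) ≤ N) :
    ∃ μ, ∀ ν, Module.finrank ℂ (P ν) ≤ Module.finrank ℂ (P μ) := by
  refine ⟨Function.argmin (fun μ => N - Module.finrank ℂ (P μ)), fun ν => ?_⟩
  have h1 := Function.argmin_le (fun μ => N - Module.finrank ℂ (P μ)) ν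
  have h2 := hN ν
  have h3 := hN (Function.argmin (fun μ => N - Module.finrank ℂ (P μ)))
  omega

/-- If `ζ` maps `P` injectively to a space of dimension at most that of `P` and `α` has values in
the same space, then `ζ⁻¹ α` is an endomorphism of `P`. -/
lemma exists_quotient (P Q : Submodule ℂ V) [FiniteDimensional ℂ P] [FiniteDimensional ℂ Q]
    (hPQ : Module.finrank ℂ Q ≤ Module.finrank ℂ P) (ζ α : Module.End ℂ V)
    (hζ : ∀ v ∈ P, ζ v ∈ Q) (hα : ∀ v ∈ P, α v ∈ Q) (hinj : ∀ v, ζ v = 0 → v = 0) :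
    ∃ X : Module.End ℂ P, ∀ v : P, ζ (X v) = α v := by
  have hinj' : Function.Injective (ζ.restrict hζ) := by
    rw [injective_iff_map_eq_zero]
    intro v hv
    exact Subtype.ext (hinj v (congrArg Subtype.val hv))
  have heq : Module.finrank ℂ P = Module.finrank ℂ Q :=
    le_antisymm (LinearMap.finrank_le_finrank_of_injective hinj') hPQ
  let F := LinearEquiv.ofInjectiveOfFinrankEq (ζ.restrict hζ) hinj' heq
  refine ⟨F.symm.toLinearMap ∘ₗ α.restrict hα, fun v => ?_⟩
  have h := congrArg Subtype.val (F.apply_symm_apply (α.restrict hα v))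
  exact h

/-- Two operators whose degrees become trivial after inverting injective central operators cannot
have an invertible commutator, by comparing traces. -/
lemma false_of_commutator (P : Λ → Submodule ℂ V) (N : ℕ) (hfin : ∀ μ, FiniteDimensional ℂ (P μ))
    (hN : ∀ μ, Module.finrank ℂ (P μ) ≤ N) (hne : ∃ μ, P μ ≠ ⊥)
    (a y Z Z' : Module.End ℂ V) (δ σ : Λ) (ha : HasDeg P a δ) (hy : HasDeg P y (σ - δ))
    (hZ : HasDeg P Z σ) (hZ' : HasDeg P Z' (σ + δ)) (c : ℂ) (hc : c ≠ 0)
    (hay : a * y - y * a = c • Z) (hZa : Commute Z a) (hZy : Commute Z y) (hZ'a : Commute Z' a)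
    (hZ'y : Commute Z' y) (hZZ' : Commute Z Z') (hinj : ∀ v, Z v = 0 → v = 0)
    (hinj' : ∀ v, Z' v = 0 → v = 0) : False := by
  obtain ⟨μ, hμ⟩ := exists_max_finrank P N hN
  have hpos : 0 < Module.finrank ℂ (P μ) := by
    obtain ⟨ν, hν⟩ := hne
    refine lt_of_lt_of_le ?_ (hμ ν)
    rw [Nat.pos_iff_ne_zero]
    intro h
    exact hν (Submodule.finrank_eq_zero.1 h)
  have hZa' : HasDeg P (Z * a) (σ + δ) := by
    have := hZ.mul ha
    rwa [add_comm] at this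
  have hZ'y' : HasDeg P (Z' * y) (σ + σ) := by
    have := hZ'.mul hy
    rwa [show σ - δ + (σ + δ) = σ + σ by abel] at this
  have hZZ2 : HasDeg P (Z * Z) (σ + σ) := hZ.mul hZ
  obtain ⟨X, hX⟩ := exists_quotient (P μ) (P (μ + (σ + δ))) (hμ _) Z' (Z * a) (hZ' μ) (hZa' μ)
    hinj'
  obtain ⟨Y, hY⟩ := exists_quotient (P μ) (P (μ + (σ + σ))) (hμ _) (Z * Z) (Z' * y) (hZZ2 μ)
    (hZ'y' μ) (fun v hv => hinj _ (hinj _ hv))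
  have hXY : X * Y - Y * X = c • (1 : Module.End ℂ (P μ)) := by
    ext v
    have e1 : (Z' * Z * Z) (X (Y v)) = (Z * Z' * a * y) v := by
      calc (Z' * Z * Z) (X (Y v)) = (Z * Z) (Z' (X (Y v))) := by
            change (Z' * Z * Z) _ = (Z * Z * Z') _
            rw [← hZZ'.eq, mul_assoc, ← hZZ'.eq, ← mul_assoc]
        _ = (Z * Z) ((Z * a) (Y v)) := by rw [hX]
        _ = (Z * a) ((Z * Z) (Y v)) := by
            change (Z * Z * (Z * a)) _ = (Z * a * (Z * Z)) _
            rw [(((Commute.refl Z).mul_left (Commute.refl Z)).mul_right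
              (hZa.mul_left hZa)).eq]
        _ = (Z * a) ((Z' * y) v) := by rw [hY]
        _ = (Z * Z' * a * y) v := by
            change (Z * a * (Z' * y)) _ = _
            congr 1
            rw [mul_assoc, ← mul_assoc a, ← hZ'a.eq]
            simp only [mul_assoc]
    have e2 : (Z' * Z * Z) (Y (X v)) = (Z * Z' * y * a) v := by
      calc (Z' * Z * Z) (Y (X v)) = Z' ((Z * Z) (Y (X v))) := rfl
        _ = Z' ((Z' * y) (X v)) := by rw [hY]
        _ = (Z' * y) (Z' (X v)) := by
            change (Z' * (Z' * y)) _ = (Z' * y * Z') _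
            rw [((Commute.refl Z').mul_right hZ'y).eq]
        _ = (Z' * y) ((Z * a) v) := by rw [hX]
        _ = (Z * Z' * y * a) v := by
            change (Z' * y * (Z * a)) _ = _
            congr 1
            rw [mul_assoc, ← mul_assoc y, ← hZy.eq, hZZ'.eq]
            simp only [mul_assoc]
    have e3 : (Z' * Z * Z) (X (Y v) - Y (X v) - c • (v : V)) = 0 := by
      rw [map_sub, map_sub, e1, e2, map_smul, ← LinearMap.sub_apply]
      have : Z * Z' * a * y - Z * Z' * y * a = c • (Z' * Z * Z) := by
        rw [mul_assoc, mul_assoc (Z * Z'), ← mul_sub, hay, mul_smul_comm, hZZ'.eq]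
      rw [this]
      simp
    exact sub_eq_zero.1 (hinj _ (hinj _ (hinj' _ e3)))
  have htr := congrArg (LinearMap.trace ℂ (P μ)) hXY
  rw [map_sub, LinearMap.trace_mul_comm, sub_self, map_smul, LinearMap.trace_one] at htr
  have : (Module.finrank ℂ (P μ) : ℂ) ≠ 0 := by exact_mod_cast hpos.ne'
  simp [hc, this] at htr

lemma exists_hasDeg_of_mem_closure (P : Λ → Submodule ℂ V) (S : Set (Module.End ℂ V))
    (hS : ∀ z ∈ S, ∃ d, HasDeg P z d) (g : Module.End ℂ V) (hg : g ∈ Submonoid.closure S) :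
    ∃ d, HasDeg P g d := by
  induction hg using Submonoid.closure_induction with
  | mem x hx => exact hS x hx
  | one => exact ⟨0, fun μ v hv => by simpa using hv⟩
  | mul x y _ _ hx hy =>
    obtain ⟨d, hd⟩ := hx
    obtain ⟨e, he⟩ := hy
    exact ⟨_, hd.mul he⟩

/-- The central commutators of Heisenberg-type operators on a space with weight spaces of bounded
dimension are locally nilpotent. -/
lemma heisenberg_locNil (P : Λ → Submodule ℂ V) (N : ℕ) (hfin : ∀ μ, FiniteDimensional ℂ (P μ))
    (hN : ∀ μ, Module.finrank ℂ (P μ) ≤ N) (hne : ∃ μ, P μ ≠ ⊥)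
    (a y Z : ℤ → Module.End ℂ V) (δ σ : Λ) (ha : ∀ j, HasDeg P (a j) (j • δ))
    (hy : ∀ j, HasDeg P (y j) (σ - j • δ)) (hZ : ∀ j, HasDeg P (Z j) (σ + j • δ))
    (c : ℂ) (hc : c ≠ 0) (hay : ∀ j l, a j * y l - y l * a j = (c * j) • Z (j - l))
    (hZa : ∀ i j, Commute (Z i) (a j)) (hZy : ∀ i j, Commute (Z i) (y j))
    (hZZ : ∀ i j, Commute (Z i) (Z j))
    (hdich : ∀ j, LocNil (Z j) ∨ ∀ v, Z j v = 0 → v = 0) : LocNil (Z 0) := by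
  refine (hdich 0).resolve_right fun hinj => ?_
  have hnil : ∀ j, j ≠ 0 → LocNil (Z j) := by
    intro j hj
    refine (hdich j).resolve_right fun hinj' => ?_
    refine false_of_commutator P N hfin hN hne (a j) (y j) (Z 0) (Z j) (j • δ) σ (ha j) (hy j)
      (by simpa using hZ 0) (hZ j) (c * j) (mul_ne_zero hc (by exact_mod_cast hj))
      (by simpa using hay j j) (hZa _ _) (hZy _ _) (hZa _ _) (hZy _ _) (hZZ _ _) hinj hinj'
  obtain ⟨μ, hμ⟩ := hne
  obtain ⟨v₀, hv₀, hv₀0⟩ := Submodule.exists_mem_ne_zero_of_ne_bot hμ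
  set M := 56 * (N * N) + 1 with hM
  let S : Set (Module.End ℂ V) :=
    Z '' (Finset.Icc (-(6 * M : ℤ)) (6 * M) \ {0} : Finset ℤ)
  have hSfin : S.Finite := (Finset.finite_toSet _).image _
  have hSfd : FiniteDimensional ℂ
      (Submodule.span ℂ ((fun z : Module.End ℂ V => z v₀) '' S)) :=
    FiniteDimensional.span_of_finite ℂ (hSfin.image _)
  obtain ⟨g, hg, hgv, hkill⟩ := exists_common_kernel S
    (by rintro _ ⟨i, _, rfl⟩ _ ⟨j, _, rfl⟩; exact hZZ i j)
    (by
      rintro _ ⟨i, hi, rfl⟩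
      refine hnil i ?_
      simp at hi
      exact hi.2) _ v₀ hv₀0 hSfd le_rfl
  obtain ⟨d, hd⟩ := exists_hasDeg_of_mem_closure P S (by rintro _ ⟨i, _, rfl⟩; exact ⟨_, hZ i⟩) g hg
  have hv := hd μ v₀ hv₀
  set v := g v₀
  have hkill' : ∀ j : ℤ, j ≠ 0 → |j| ≤ 6 * M → Z j v = 0 := by
    intro j hj hj'
    refine hkill _ ⟨j, ?_, rfl⟩
    simp [hj]
    exact abs_le.1 hj'
  obtain ⟨c', hc', hrel⟩ := exists_triple_relation P N M hM hfin hN (fun k => a (k + 1)) δ δ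
    (fun k => by
      have := ha (k + 1)
      convert this using 1
      rw [add_smul, one_smul, natCast_zsmul, add_comm]) (μ + d) (fun _ => σ - δ)
  obtain ⟨q, hq⟩ := Function.ne_iff.1 hc'
  have key := hrel (triple M (q, 0)) (fun j => y (triple M (q, 0) j + 1))
    (fun j k => -((c * ((k + 1 : ℤ) : ℂ)) • Z ((k : ℤ) - triple M (q, 0) j)))
    (triple_sum M _)
    (fun j => by
      have := hy (triple M (q, 0) j + 1)
      convert this using 1
      rw [add_smul, one_smul, natCast_zsmul]
      abel)
    (fun j k => by
      rw [innerDer_apply, ← neg_sub, hay]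
      congr 3
      ring)
    (fun i j k => by
      rw [innerDer_apply, sub_eq_zero]
      exact ((((hZy _ _).smul_left _).neg_left).symm).eq)
    (fun i j k l => (((hZZ _ _).smul_left _).neg_left.smul_right _).neg_right) v hv
  have hz : ∀ (i : ℤ), i ≠ 0 → |i| ≤ 6 * M → ∀ s : ℂ, ∀ j j' : ℤ, ∀ s' s'' : ℂ,
      ((-(s • Z i)) * (-(s' • Z j)) * (-(s'' • Z j'))) v = 0 ∧
      ((-(s' • Z j)) * (-(s • Z i)) * (-(s'' • Z j'))) v = 0 ∧
      ((-(s' • Z j)) * (-(s'' • Z j')) * (-(s • Z i))) v = 0 := by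
    intro i hi hi' s j j' s' s''
    have h3 : ((-(s' • Z j)) * (-(s'' • Z j')) * (-(s • Z i))) v = 0 := by
      simp [hkill' i hi hi']
    have hcm : ∀ (t t' : ℂ) (u u' : ℤ), Commute (-(t • Z u)) (-(t' • Z u')) := fun t t' u u' =>
      (((hZZ _ _).smul_left _).neg_left.smul_right _).neg_right
    refine ⟨?_, ?_, h3⟩
    · rw [mul_assoc, ((hcm s s' i j).mul_right (hcm s s'' i j')).eq]
      exact h3
    · rw [mul_assoc, (hcm s s'' i j').eq, ← mul_assoc]
      exact h3
  rw [Finset.sum_eq_single (q, 0)] at key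
  · simp only [sub_self] at key
    have hcube : (Z 0 * Z 0 * Z 0) v ≠ 0 := fun h => hgv (hinj _ (hinj _ (hinj _ h)))
    simp only [← neg_smul, smul_mul_assoc, mul_smul_comm, LinearMap.smul_apply] at key
    have hne' : ∀ k : ℕ, -(c * ((k + 1 : ℤ) : ℂ)) ≠ 0 := by
      intro k
      refine neg_ne_zero.2 (mul_ne_zero hc ?_)
      have : (k : ℤ) + 1 ≠ 0 := by omega
      exact_mod_cast this
    exact (smul_ne_zero hq (smul_ne_zero (hne' _) (smul_ne_zero (hne' _)
      (smul_ne_zero (hne' _) hcube)))) key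
  · intro q' _ hq'
    have hb : ∀ j, |(triple M q' j : ℤ) - triple M (q, 0) j| ≤ 6 * M := by
      intro j
      have h1 := triple_le M q' j
      have h2 := triple_le M (q, 0) j
      rw [abs_le]
      constructor <;> omega
    by_cases h0 : triple M q' 0 = triple M (q, 0) 0
    · by_cases h1 : triple M q' 1 = triple M (q, 0) 1
      · exact absurd (triple_inj M q' (q, 0) h0 h1) hq'
      · rw [(hz _ (by omega) (hb 1) _ _ _ _ _).2.1, smul_zero]
    · rw [(hz _ (by omega) (hb 0) _ _ _ _ _).1, smul_zero]
  · simp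

end HeisenbergArgument

section CommonNullVector

variable {n : ℕ} {B V Λ : Type*} [AddCommGroup V] [Module ℂ V] [AddCommGroup Λ]

lemma exists_third_index (hn : 3 ≤ n) (j l : Fin n) : ∃ i : Fin n, i ≠ j ∧ i ≠ l := by
  classical
  have : (({j, l} : Finset (Fin n))ᶜ).Nonempty := by
    rw [← Finset.card_pos, Finset.card_compl, Fintype.card_fin]
    have := Finset.card_le_two (a := j) (b := l)
    omega
  obtain ⟨i, hi⟩ := this
  simp at hi
  exact ⟨i, hi.1, hi.2⟩

/-- If `v` is killed by all `k e j b` with `|e l|` small, then triple products of the operators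
`k e j b` kill `v` without restriction on `e l`. -/
lemma triple_product_vanishes (hn : 3 ≤ n) (P : Λ → Submodule ℂ V) (N M : ℕ)
    (hM : M = 56 * (N * N) + 1) (hfin : ∀ μ, FiniteDimensional ℂ (P μ))
    (hN : ∀ μ, Module.finrank ℂ (P μ) ≤ N) (deg : (Fin n → ℤ) →+ Λ)
    (k : (Fin n → ℤ) → Fin n → B → Module.End ℂ V) (w : (Fin n → ℤ) → Fin n → Module.End ℂ V)
    (hk : ∀ m i b, HasDeg P (k m i b) (deg m)) (hw : ∀ m i, HasDeg P (w m i) (deg m))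
    (hkk : ∀ m i b m' i' b', Commute (k m i b) (k m' i' b'))
    (hwk : ∀ m i q j b, i ≠ j →
      w m i * k q j b - k q j b * w m i = (q i : ℂ) • k (m + q) j b)
    (G : (Fin n → ℤ) → Prop) (l j : Fin n)
    (hG : ∀ e, G e → ∀ t : ℤ, G (e + t • Pi.single l 1))
    (μ : Λ) (v : V) (hv : v ∈ P μ)
    (hkill : ∀ e, G e → |e l| ≤ 6 * M → ∀ b, k e j b v = 0) (b : Fin 3 → B) :
    ∀ (s s' : ℕ) (e : Fin 3 → Fin n → ℤ), (∀ a, G (e a)) → (e 0 l).natAbs = s →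
      (e 1 l).natAbs = s' →
      (k (e 0) j (b 0) * k (e 1) j (b 1) * k (e 2) j (b 2)) v = 0 := by
  intro s
  induction s using Nat.strong_induction_on with
  | _ s ih =>
  intro s'
  induction s' using Nat.strong_induction_on with
  | _ s' ih' =>
  intro e he hs hs'
  by_cases h0 : |e 0 l| ≤ 6 * M
  · rw [mul_assoc, ((hkk _ _ _ _ _ _).mul_right (hkk _ _ _ _ _ _)).eq, Module.End.mul_apply,
      hkill _ (he 0) h0, map_zero]
  by_cases h1 : |e 1 l| ≤ 6 * M
  · rw [mul_assoc, (hkk _ _ _ _ _ _).eq, ← mul_assoc, Module.End.mul_apply,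
      hkill _ (he 1) h1, map_zero]
  obtain ⟨i, hij, hil⟩ := exists_third_index hn j l
  set ω : ℤ := |e 0 i| + |e 1 i| + |e 2 i| + 1 with hω
  have hωne : ∀ a, e a i - ω ≠ 0 := by
    intro a
    have a0 := le_abs_self (e 0 i)
    have a1 := le_abs_self (e 1 i)
    have a2 := le_abs_self (e 2 i)
    have b0 := abs_nonneg (e 0 i)
    have b1 := abs_nonneg (e 1 i)
    have b2 := abs_nonneg (e 2 i)
    fin_cases a <;> simp <;> omega
  set r : Fin n → ℤ := Pi.single l 1 with hr
  have hri : r i = 0 := by simp [hr, hil]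
  have hrl : r l = 1 := by simp [hr]
  set w₀ : Fin n → ℤ := Pi.single i ω with hw₀
  have hwi : w₀ i = ω := by simp [hw₀]
  obtain ⟨c, hc, hrel⟩ := exists_triple_relation P N M hM hfin hN
    (fun t => w (w₀ + (t : ℤ) • r) i) (deg w₀) (deg r)
    (fun t => by
      have := hw (w₀ + (t : ℤ) • r) i
      rwa [map_add, map_zsmul, natCast_zsmul (deg r)] at this) μ (fun a => deg (e a - w₀))
  classical
  let I : Finset ((Fin M × Fin M) × Fin 6) := Finset.univ.filter fun q => c q.1 ≠ 0
  have hI : I.Nonempty := by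
    obtain ⟨q, hq⟩ := Function.ne_iff.1 hc
    exact ⟨(q, 0), by simpa [I] using hq⟩
  obtain ⟨q, hqI, hqmax⟩ := Finset.exists_max_image I
    (fun q => toLex ((e 0 l).sign * (triple M q 0 : ℤ), (e 1 l).sign * (triple M q 1 : ℤ))) hI
  have hcq : c q.1 ≠ 0 := by simpa [I] using hqI
  have key := hrel (triple M q) (fun a => k (e a - w₀ - (triple M q a : ℤ) • r) j (b a))
    (fun a t => -(((e a i - ω : ℤ) : ℂ) • k (e a + ((t : ℤ) - triple M q a) • r) j (b a)))
    (triple_sum M q)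
    (fun a => by
      have := hk (e a - w₀ - (triple M q a : ℤ) • r) j (b a)
      rwa [map_sub, map_zsmul, natCast_zsmul (deg r)] at this)
    (fun a t => by
      rw [innerDer_apply, ← neg_sub, hwk _ _ _ _ _ hij]
      congr 2
      · simp [hri, hwi]
      · congr 1
        rw [sub_smul]
        abel)
    (fun a a' t => by
      rw [innerDer_apply, sub_eq_zero]
      exact (((hkk _ _ _ _ _ _).smul_right _).neg_right).eq)
    (fun a a' t t' => (((hkk _ _ _ _ _ _).smul_left _).neg_left.smul_right _).neg_right) v hv
  simp only [← neg_smul, smul_mul_assoc, mul_smul_comm, LinearMap.smul_apply] at key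
  rw [Finset.sum_eq_single q] at key
  · simp only [sub_self, zero_smul, add_zero] at key
    have hne : ∀ a, -((e a i - ω : ℤ) : ℂ) ≠ 0 := fun a =>
      neg_ne_zero.2 (by exact_mod_cast hωne a)
    by_contra hcon
    exact smul_ne_zero hcq (smul_ne_zero (hne _) (smul_ne_zero (hne _)
      (smul_ne_zero (hne _) hcon))) key
  · intro q' _ hq'
    by_cases hcq' : c q'.1 = 0
    · rw [hcq', zero_smul]
    have hle := hqmax q' (by simpa [I] using hcq')
    have hb0 := triple_le M q 0
    have hb1 := triple_le M q 1
    have hb0' := triple_le M q' 0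
    have hb1' := triple_le M q' 1
    rw [Prod.Lex.toLex_le_toLex] at hle
    have hstep : ∀ x t t' : ℤ, ¬ |x| ≤ 6 * M → 0 ≤ t → t ≤ 6 * M → 0 ≤ t' → t' ≤ 6 * M →
        x.sign * t' ≤ x.sign * t → t' ≠ t → (x + (t' - t)).natAbs < x.natAbs := by
      intro x t t' hx ht0 ht ht0' ht' hsg hne
      rcases lt_trichotomy x 0 with hx0 | hx0 | hx0
      · rw [Int.sign_eq_neg_one_of_neg hx0] at hsg
        rw [abs_of_neg hx0] at hx
        omega
      · rw [hx0] at hx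
        simp at hx
      · rw [Int.sign_eq_one_of_pos hx0] at hsg
        rw [abs_of_pos hx0] at hx
        omega
    have hG' : ∀ a, G (e a + ((triple M q' a : ℤ) - triple M q a) • r) := fun a => hG _ (he a) _
    have hvan : (k (e 0 + ((triple M q' 0 : ℤ) - triple M q 0) • r) j (b 0) *
        k (e 1 + ((triple M q' 1 : ℤ) - triple M q 1) • r) j (b 1) *
        k (e 2 + ((triple M q' 2 : ℤ) - triple M q 2) • r) j (b 2)) v = 0 := by
      by_cases h00 : triple M q' 0 = triple M q 0
      · have h11 : triple M q' 1 ≠ triple M q 1 := fun h11 =>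
          hq' (triple_inj M q' q h00 h11)
        have hlt : (e 1 l + ((triple M q' 1 : ℤ) - triple M q 1)).natAbs < s' := by
          rw [← hs']
          refine hstep _ _ _ h1 (by omega) (by omega) (by omega) (by omega) ?_ (by omega)
          rcases hle with hle | hle
          · simp [h00] at hle
          · exact hle.2
        exact ih' _ hlt (fun a => e a + ((triple M q' a : ℤ) - triple M q a) • r) hG'
          (by simp [h00, hs]) (by simp [hrl])
      · have hlt : (e 0 l + ((triple M q' 0 : ℤ) - triple M q 0)).natAbs < s := by
          rw [← hs]
          refine hstep _ _ _ h0 (by omega) (by omega) (by omega) (by omega) ?_ (by omega)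
          rcases hle with hle | hle
          · exact hle.le
          · exact hle.1.le
        exact ih _ hlt _ (fun a => e a + ((triple M q' a : ℤ) - triple M q a) • r) hG'
          (by simp [hrl]) rfl
    rw [hvan]
    simp
  · simp

/-- Commuting locally nilpotent operators `k m i b` as in the full toroidal Lie algebra have a
common null vector on a space with weight spaces of bounded dimension. -/
lemma exists_null_vector (hn : 3 ≤ n) (P : Λ → Submodule ℂ V) (N : ℕ)
    (hfin : ∀ μ, FiniteDimensional ℂ (P μ))
    (hN : ∀ μ, Module.finrank ℂ (P μ) ≤ N) (hne : ∃ μ, P μ ≠ ⊥) (deg : (Fin n → ℤ) →+ Λ)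
    (k : (Fin n → ℤ) → Fin n → B → Module.End ℂ V) (w : (Fin n → ℤ) → Fin n → Module.End ℂ V)
    (hk : ∀ m i b, HasDeg P (k m i b) (deg m)) (hw : ∀ m i, HasDeg P (w m i) (deg m))
    (hkk : ∀ m i b m' i' b', Commute (k m i b) (k m' i' b'))
    (hwk : ∀ m i q j b, i ≠ j →
      w m i * k q j b - k q j b * w m i = (q i : ℂ) • k (m + q) j b)
    (hnil : ∀ m i b, LocNil (k m i b)) :
    ∃ v, v ≠ 0 ∧ ∀ m i b, k m i b v = 0 := by
  classical
  set M := 56 * (N * N) + 1 with hM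
  suffices H : ∀ T : Finset (Fin n), ∃ μ, ∃ v ∈ P μ, v ≠ 0 ∧
      ∀ e : Fin n → ℤ, (∀ i, i ∉ T → |e i| ≤ 6 * M) → ∀ j b, k e j b v = 0 by
    obtain ⟨μ, v, -, hv0, hv⟩ := H Finset.univ
    exact ⟨v, hv0, fun m i b => hv m (by simp) i b⟩
  intro T
  induction T using Finset.induction_on with
  | empty =>
    obtain ⟨μ, hμ⟩ := hne
    obtain ⟨v, hv, hv0⟩ := Submodule.exists_mem_ne_zero_of_ne_bot hμ
    let F : Finset (Fin n → ℤ) := Fintype.piFinset fun _ => Finset.Icc (-(6 * M : ℤ)) (6 * M)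
    let S : Set (Module.End ℂ V) := {z | ∃ e ∈ F, ∃ j b, z = k e j b}
    have hle : Submodule.span ℂ ((fun z : Module.End ℂ V => z v) '' S) ≤
        F.sup fun e => P (μ + deg e) := by
      rw [Submodule.span_le]
      rintro _ ⟨_, ⟨e, he, j, b, rfl⟩, rfl⟩
      exact (Finset.le_sup (f := fun e => P (μ + deg e)) he) (hk e j b μ v hv)
    have hfd : FiniteDimensional ℂ (F.sup fun e => P (μ + deg e) : Submodule ℂ V) :=
      Submodule.finiteDimensional_finset_sup F _
    obtain ⟨g, hg, hgv, hkill⟩ := exists_common_kernel S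
      (by rintro _ ⟨e, _, j, b, rfl⟩ _ ⟨e', _, j', b', rfl⟩; exact hkk _ _ _ _ _ _)
      (by rintro _ ⟨e, _, j, b, rfl⟩; exact hnil _ _ _) _ v hv0
      (Submodule.finiteDimensional_of_le hle) le_rfl
    obtain ⟨d, hd⟩ := exists_hasDeg_of_mem_closure P S
      (by rintro _ ⟨e, _, j, b, rfl⟩; exact ⟨_, hk _ _ _⟩) g hg
    refine ⟨μ + d, g v, hd μ v hv, hgv, fun e he j b => hkill _ ⟨e, ?_, j, b, rfl⟩⟩
    rw [Fintype.mem_piFinset]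
    intro i
    rw [Finset.mem_Icc]
    exact abs_le.1 (he i (by simp))
  | insert l T hl ihT =>
    suffices H : ∀ J : Finset (Fin n), ∃ μ, ∃ v ∈ P μ, v ≠ 0 ∧
        (∀ e : Fin n → ℤ, (∀ i, i ∉ T → |e i| ≤ 6 * M) → ∀ j b, k e j b v = 0) ∧
        ∀ j ∈ J, ∀ e : Fin n → ℤ, (∀ i, i ∉ insert l T → |e i| ≤ 6 * M) →
          ∀ b, k e j b v = 0 by
      obtain ⟨μ, v, hv, hv0, -, h⟩ := H Finset.univ
      exact ⟨μ, v, hv, hv0, fun e he j b => h j (Finset.mem_univ j) e he b⟩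
    intro J
    induction J using Finset.induction_on with
    | empty =>
      obtain ⟨μ, v, hv, hv0, h⟩ := ihT
      exact ⟨μ, v, hv, hv0, h, by simp⟩
    | insert j J _ ihJ =>
      obtain ⟨μ, v, hv, hv0, h, hJ⟩ := ihJ
      let G : (Fin n → ℤ) → Prop := fun e => ∀ i, i ∉ insert l T → |e i| ≤ 6 * M
      have htriple : ∀ (e : Fin 3 → Fin n → ℤ) (b : Fin 3 → B), (∀ a, G (e a)) →
          (k (e 0) j (b 0) * k (e 1) j (b 1) * k (e 2) j (b 2)) v = 0 := by
        intro e b he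
        refine triple_product_vanishes hn P N M hM hfin hN deg k w hk hw hkk hwk G l j ?_ μ v hv
          ?_ b _ _ e he rfl rfl
        · intro e he t i hi
          have hil : i ≠ l := fun hil => hi (by simp [hil])
          simpa [hil] using he i hi
        · intro e he hel b
          refine h e (fun i hi => ?_) j b
          by_cases hil : i = l
          · rw [hil]
            exact hel
          · exact he i (by simp [hil, hi])
      have extend : ∀ (z : Module.End ℂ V) (d : Λ), HasDeg P z d →
          (∀ e j b, Commute (k e j b) z) → z v ≠ 0 → (∀ e b, G e → k e j b (z v) = 0) →
          ∃ μ, ∃ v ∈ P μ, v ≠ 0 ∧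
            (∀ e : Fin n → ℤ, (∀ i, i ∉ T → |e i| ≤ 6 * M) → ∀ j b, k e j b v = 0) ∧
            ∀ j' ∈ insert j J, ∀ e : Fin n → ℤ, (∀ i, i ∉ insert l T → |e i| ≤ 6 * M) →
              ∀ b, k e j' b v = 0 := by
        intro z d hz hcomm hzv hzk
        have hpass : ∀ e j b, k e j b v = 0 → k e j b (z v) = 0 := by
          intro e j b h0
          rw [← Module.End.mul_apply, (hcomm e j b).eq, Module.End.mul_apply, h0, map_zero]
        refine ⟨μ + d, z v, hz μ v hv, hzv, fun e he j b => hpass _ _ _ (h e he j b), ?_⟩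
        intro j' hj' e he b
        rcases Finset.mem_insert.1 hj' with rfl | hj'
        · exact hzk e b he
        · exact hpass _ _ _ (hJ j' hj' e he b)
      by_cases h2 : ∀ e e' b b', G e → G e' → (k e j b * k e' j b') v = 0
      · by_cases h1 : ∀ e b, G e → k e j b v = 0
        · refine extend 1 0 (fun μ v hv => by simpa using hv) (fun _ _ _ => Commute.one_right _)
            (by simpa using hv0) (by simpa using h1)
        · push Not at h1
          obtain ⟨e, b, he, hne1⟩ := h1
          exact extend _ _ (hk e j b) (fun _ _ _ => hkk _ _ _ _ _ _) hne1
            (fun e' b' he' => h2 e' e b' b he' he)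
      · push Not at h2
        obtain ⟨e, e', b, b', he, he', hne2⟩ := h2
        refine extend _ _ ((hk e j b).mul (hk e' j b'))
          (fun _ _ _ => (hkk _ _ _ _ _ _).mul_right (hkk _ _ _ _ _ _)) hne2 ?_
        intro e'' b'' he''
        have := htriple ![e'', e, e'] ![b'', b, b'] (by
          intro a
          fin_cases a
          · exact he''
          · exact he
          · exact he')
        simpa using this

end CommonNullVector

section IrreducibleModules

variable {L V : Type*} [LieRing L] [LieAlgebra ℂ L] [AddCommGroup V] [Module ℂ V]
  [LieRingModule L V] [LieModule ℂ L V]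

/-- The action of a commutator. -/
lemma toEnd_lie (x y : L) : LieModule.toEnd ℂ L V ⁅x, y⁆ =
    LieModule.toEnd ℂ L V x * LieModule.toEnd ℂ L V y -
      LieModule.toEnd ℂ L V y * LieModule.toEnd ℂ L V x := by
  ext v
  exact lie_lie x y v

lemma toEnd_commute (x y : L) (h : ⁅x, y⁆ = 0) :
    Commute (LieModule.toEnd ℂ L V x) (LieModule.toEnd ℂ L V y) := by
  rw [commute_iff_eq, ← sub_eq_zero, ← toEnd_lie, h, map_zero]

/-- An element with `(ad z)² = 0` acts on an irreducible module either locally nilpotently or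
injectively. -/
lemma locNil_or_injective (hirr : LieModule.IsIrreducible ℂ L V) (z : L)
    (hz : ∀ x : L, ⁅z, ⁅z, x⁆⁆ = 0) :
    LocNil (LieModule.toEnd ℂ L V z) ∨ ∀ v, LieModule.toEnd ℂ L V z v = 0 → v = 0 := by
  set ζ := LieModule.toEnd ℂ L V z with hζ
  have hmono : ∀ v p q, p ≤ q → (ζ ^ p) v = 0 → (ζ ^ q) v = 0 := by
    intro v p q hpq h
    obtain ⟨r, rfl⟩ := Nat.exists_eq_add_of_le' hpq
    rw [pow_add, Module.End.mul_apply, h, map_zero]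
  have hpow : ∀ (x : L) (v : V) (p : ℕ),
      (ζ ^ p) ⁅⁅z, x⁆, v⁆ = ⁅⁅z, x⁆, (ζ ^ p) v⁆ := by
    intro x v p
    have h1 : Commute (LieModule.toEnd ℂ L V ⁅z, x⁆) ζ :=
      toEnd_commute _ _ (by rw [← lie_skew, hz, neg_zero])
    exact (LinearMap.congr_fun (h1.pow_right p).eq v).symm
  have hcomm : ∀ (x : L) (v : V) (p : ℕ), (ζ ^ (p + 1)) ⁅x, v⁆ =
      ⁅x, (ζ ^ (p + 1)) v⁆ + (p + 1 : ℂ) • ⁅⁅z, x⁆, (ζ ^ p) v⁆ := by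
    intro x v p
    induction p with
    | zero =>
      simp only [zero_add, pow_one, pow_zero, Module.End.one_apply, Nat.cast_zero, one_smul, hζ,
        LieModule.toEnd_apply_apply]
      rw [leibniz_lie, add_comm]
    | succ p ih =>
      rw [pow_succ' ζ (p + 1), Module.End.mul_apply, ih, map_add, map_smul]
      have h1 : ζ ⁅x, (ζ ^ (p + 1)) v⁆ =
          ⁅⁅z, x⁆, (ζ ^ (p + 1)) v⁆ + ⁅x, (ζ * ζ ^ (p + 1)) v⁆ := leibniz_lie z x _
      have h2 : ζ ⁅⁅z, x⁆, (ζ ^ p) v⁆ = ⁅⁅z, x⁆, (ζ ^ (p + 1)) v⁆ := by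
        have := hpow x ((ζ ^ p) v) 1
        rw [pow_one] at this
        rw [this, pow_succ', Module.End.mul_apply]
      rw [h1, h2]
      push_cast
      module
  let U : LieSubmodule ℂ L V :=
    { carrier := {v | ∃ p : ℕ, (ζ ^ p) v = 0}
      add_mem' := by
        rintro v w ⟨p, hp⟩ ⟨q, hq⟩
        refine ⟨max p q, ?_⟩
        rw [map_add, hmono v p _ (le_max_left _ _) hp, hmono w q _ (le_max_right _ _) hq, add_zero]
      zero_mem' := ⟨0, map_zero _⟩
      smul_mem' := by
        rintro c v ⟨p, hp⟩
        exact ⟨p, by rw [map_smul, hp, smul_zero]⟩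
      lie_mem := by
        rintro x v ⟨p, hp⟩
        refine ⟨p + 1, ?_⟩
        rw [hcomm, hmono v p (p + 1) (Nat.le_succ p) hp, hp]
        simp }
  rcases hirr.eq_bot_or_eq_top U with h | h
  · right
    intro v hv
    have : v ∈ U := ⟨1, by rw [pow_one, hv]⟩
    rwa [h, LieSubmodule.mem_bot] at this
  · left
    intro v
    have : v ∈ U := h ▸ LieSubmodule.mem_top v
    exact this

/-- An ideal killing a nonzero vector of an irreducible module kills the module. -/
lemma lie_eq_zero_of_exists (hirr : LieModule.IsIrreducible ℂ L V) (S : Set L)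
    (hS : ∀ x : L, ∀ z ∈ S, ⁅x, z⁆ ∈ Submodule.span ℂ S)
    (hex : ∃ v : V, v ≠ 0 ∧ ∀ z ∈ S, ⁅z, v⁆ = 0) (z : L) (hz : z ∈ S) (v : V) : ⁅z, v⁆ = 0 := by
  have hspan : ∀ v : V, (∀ z ∈ S, ⁅z, v⁆ = 0) → ∀ y ∈ Submodule.span ℂ S, ⁅y, v⁆ = 0 := by
    intro v hv y hy
    induction hy using Submodule.span_induction with
    | mem y hy => exact hv y hy
    | zero => exact zero_lie v
    | add y y' _ _ h h' => rw [add_lie, h, h', add_zero]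
    | smul c y _ h => rw [smul_lie, h, smul_zero]
  let U : LieSubmodule ℂ L V :=
    { carrier := {v | ∀ z ∈ S, ⁅z, v⁆ = 0}
      add_mem' := by
        intro v w hv hw z hz
        rw [lie_add, hv z hz, hw z hz, add_zero]
      zero_mem' := fun z _ => lie_zero z
      smul_mem' := by
        intro c v hv z hz
        rw [lie_smul, hv z hz, smul_zero]
      lie_mem := by
        intro x v hv z hz
        rw [leibniz_lie, hv z hz, lie_zero, add_zero, ← lie_skew, neg_lie,
          hspan v hv _ (hS x z hz), neg_zero] }
  obtain ⟨v₀, hv₀, hv₀'⟩ := hex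
  rcases hirr.eq_bot_or_eq_top U with h | h
  · have : v₀ ∈ U := hv₀'
    rw [h, LieSubmodule.mem_bot] at this
    exact absurd this hv₀
  · have : v ∈ U := h ▸ LieSubmodule.mem_top v
    exact this z hz

/-- An operator of weight `l` for the operators `d` has degree `l`. -/
lemma hasDeg_toEnd {n : ℕ} (d : Fin n → L) (x : L) (l : Fin n → ℂ)
    (hx : ∀ i, ⁅d i, x⁆ = l i • x) :
    HasDeg (weightSpace (V := V) d) (LieModule.toEnd ℂ L V x) l := by
  intro μ v hv i
  rw [LieModule.toEnd_apply_apply, leibniz_lie, hx, hv i, smul_lie, lie_smul, Pi.add_apply,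
    add_smul, add_comm]

end IrreducibleModules

section Toroidal

variable {κ : 𝔤 →ₗ[ℂ] 𝔤 →ₗ[ℂ] ℂ} {c₁ c₂ : ℂ} {E : (Fin n → ℤ) → 𝔤 →ₗ[ℂ] τ}
  {K W : (Fin n → ℤ) → Fin n → τ} {B : Type} [CommRing B] [Algebra ℂ B]

lemma tmul_lie_tmul (a b : B) (x y : τ) :
    ⁅a ⊗ₜ[ℂ] x, b ⊗ₜ[ℂ] y⁆ = (a * b) ⊗ₜ[ℂ] ⁅x, y⁆ :=
  LieAlgebra.ExtendScalars.bracket_tmul ℂ B τ τ a b x y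

lemma dOp_lie_tmul (b : B) (x : τ) (i : Fin n) (c : ℂ) (h : ⁅W 0 i, x⁆ = c • x) :
    ⁅dOp B W i, b ⊗ₜ[ℂ] x⁆ = c • (b ⊗ₜ[ℂ] x) := by
  rw [dOp, tmul_lie_tmul, h, one_mul, TensorProduct.tmul_smul]

/-- The generators of `𝒦(B)`. -/
def kernelGens (B : Type) [CommRing B] [Algebra ℂ B] (K : (Fin n → ℤ) → Fin n → τ) :
    Set (B ⊗[ℂ] τ) :=
  {z | ∃ (a : B) (m : Fin n → ℤ) (i : Fin n), z = a ⊗ₜ[ℂ] K m i}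

lemma lie_mem_span_kernelGens (hτ : IsFullToroidal n 𝔤 τ κ c₁ c₂ E K W) (x : B ⊗[ℂ] τ) :
    ∀ z ∈ kernelGens B K, ⁅x, z⁆ ∈ Submodule.span ℂ (kernelGens B K) := by
  rintro _ ⟨a, m, i, rfl⟩
  have hgen : ∀ (b : B) m i, b ⊗ₜ[ℂ] K m i ∈ Submodule.span ℂ (kernelGens B K) :=
    fun b m i => Submodule.subset_span ⟨b, m, i, rfl⟩
  induction x using TensorProduct.induction_on with
  | zero => rw [zero_lie]; exact zero_mem _
  | add x y hx hy => rw [add_lie]; exact add_mem hx hy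
  | tmul b X =>
    have hX : X ∈ (⊤ : Submodule ℂ τ) := trivial
    rw [← hτ.span_eq_top] at hX
    rw [tmul_lie_tmul]
    induction hX using Submodule.span_induction with
    | zero => rw [zero_lie, TensorProduct.tmul_zero]; exact zero_mem _
    | add X Y _ _ hX hY => rw [add_lie, TensorProduct.tmul_add]; exact add_mem hX hY
    | smul c X _ hX =>
      rw [smul_lie, TensorProduct.tmul_smul]
      exact Submodule.smul_mem _ _ hX
    | mem X hX =>
      rcases hX with (⟨q, x, rfl⟩ | ⟨q, j, rfl⟩) | ⟨q, j, rfl⟩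
      · rw [hτ.lie_E_K, TensorProduct.tmul_zero]; exact zero_mem _
      · rw [hτ.lie_K_K, TensorProduct.tmul_zero]; exact zero_mem _
      · rw [hτ.lie_W_K, TensorProduct.tmul_add, TensorProduct.tmul_smul]
        refine add_mem (Submodule.smul_mem _ _ (hgen _ _ _)) ?_
        split_ifs
        · rw [TensorProduct.tmul_sum]
          refine sum_mem fun p _ => ?_
          rw [TensorProduct.tmul_smul]
          exact Submodule.smul_mem _ _ (hgen _ _ _)
        · rw [TensorProduct.tmul_zero]; exact zero_mem _

lemma kernelGens_lie_kernelGens (hτ : IsFullToroidal n 𝔤 τ κ c₁ c₂ E K W) (a b : B)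
    (m q : Fin n → ℤ) (i j : Fin n) : ⁅a ⊗ₜ[ℂ] K m i, b ⊗ₜ[ℂ] K q j⁆ = 0 := by
  rw [tmul_lie_tmul, hτ.lie_K_K, TensorProduct.tmul_zero]

lemma kernelGens_lie_lie (hτ : IsFullToroidal n 𝔤 τ κ c₁ c₂ E K W) (a : B)
    (m : Fin n → ℤ) (i : Fin n) (x : B ⊗[ℂ] τ) :
    ⁅a ⊗ₜ[ℂ] K m i, ⁅a ⊗ₜ[ℂ] K m i, x⁆⁆ = 0 := by
  have hx := lie_mem_span_kernelGens hτ x (a ⊗ₜ[ℂ] K m i) ⟨a, m, i, rfl⟩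
  rw [← lie_skew _ x, lie_neg, neg_eq_zero]
  generalize ⁅x, a ⊗ₜ[ℂ] K m i⁆ = u at hx ⊢
  induction hx using Submodule.span_induction with
  | mem y hy =>
    obtain ⟨b, q, j, rfl⟩ := hy
    exact kernelGens_lie_kernelGens hτ a b m q i j
  | zero => exact lie_zero _
  | add y y' _ _ h h' => rw [lie_add, h, h', add_zero]
  | smul c y _ h => rw [lie_smul, h, smul_zero]

lemma exists_form_self_ne_zero [Nontrivial 𝔤] (hτ : IsFullToroidal n 𝔤 τ κ c₁ c₂ E K W) :
    ∃ h : 𝔤, κ h h ≠ 0 := by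
  by_contra! hcon
  obtain ⟨x, hx⟩ := exists_ne (0 : 𝔤)
  refine hx (hτ.κ_nondeg x fun y => ?_)
  have h := hcon (x + y)
  rw [map_add, map_add, LinearMap.add_apply, LinearMap.add_apply, hcon x, hcon y,
    hτ.κ_symm y x, zero_add, add_zero] at h
  exact self_eq_neg.1 (eq_neg_of_add_eq_zero_left h)

/-- The degree `m ∈ ℤⁿ` as a weight. -/
def intWeight (n : ℕ) : (Fin n → ℤ) →+ (Fin n → ℂ) where
  toFun m i := (m i : ℂ)
  map_zero' := by ext; simp
  map_add' m q := by ext; simp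

variable {V : Type} [AddCommGroup V] [Module ℂ V] [LieRingModule (B ⊗[ℂ] τ) V]
  [LieModule ℂ (B ⊗[ℂ] τ) V]

lemma hasDeg_E (hτ : IsFullToroidal n 𝔤 τ κ c₁ c₂ E K W) (b : B) (m : Fin n → ℤ) (x : 𝔤) :
    HasDeg (weightSpace (V := V) (dOp B W)) (LieModule.toEnd ℂ (B ⊗[ℂ] τ) V (b ⊗ₜ[ℂ] E m x))
      (intWeight n m) := by
  refine hasDeg_toEnd _ _ _ fun i => dOp_lie_tmul _ _ _ _ ?_
  rw [hτ.lie_W_E, zero_add]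
  rfl

lemma hasDeg_K (hτ : IsFullToroidal n 𝔤 τ κ c₁ c₂ E K W) (b : B) (m : Fin n → ℤ) (j : Fin n) :
    HasDeg (weightSpace (V := V) (dOp B W)) (LieModule.toEnd ℂ (B ⊗[ℂ] τ) V (b ⊗ₜ[ℂ] K m j))
      (intWeight n m) := by
  refine hasDeg_toEnd _ _ _ fun i => dOp_lie_tmul _ _ _ _ ?_
  rw [hτ.lie_W_K, zero_add]
  simp [intWeight]

lemma hasDeg_W (hτ : IsFullToroidal n 𝔤 τ κ c₁ c₂ E K W) (b : B) (m : Fin n → ℤ) (j : Fin n) :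
    HasDeg (weightSpace (V := V) (dOp B W)) (LieModule.toEnd ℂ (B ⊗[ℂ] τ) V (b ⊗ₜ[ℂ] W m j))
      (intWeight n m) := by
  refine hasDeg_toEnd _ _ _ fun i => dOp_lie_tmul _ _ _ _ ?_
  rw [hτ.lie_W_W, zero_add]
  simp [intWeight]

/-- Elements of `𝒦(B)` act locally nilpotently on irreducible cuspidal modules. -/
lemma locNil_kernelGens [Nontrivial 𝔤] (hτ : IsFullToroidal n 𝔤 τ κ c₁ c₂ E K W)
    (hirr : LieModule.IsIrreducible ℂ (B ⊗[ℂ] τ) V) (N : ℕ)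
    (hfin : ∀ l, FiniteDimensional ℂ (weightSpace (V := V) (dOp B W) l))
    (hN : ∀ l, Module.finrank ℂ (weightSpace (V := V) (dOp B W) l) ≤ N)
    (hne : ∃ l, weightSpace (V := V) (dOp B W) l ≠ ⊥) (s : Fin n → ℤ) (i : Fin n) (b : B) :
    LocNil (LieModule.toEnd ℂ (B ⊗[ℂ] τ) V (b ⊗ₜ[ℂ] K s i)) := by
  obtain ⟨h, hh⟩ := exists_form_self_ne_zero hτ
  set p : Fin n → ℤ := Pi.single i 1 with hp
  have key := heisenberg_locNil (weightSpace (V := V) (dOp B W)) N hfin hN hne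
    (fun j => LieModule.toEnd ℂ (B ⊗[ℂ] τ) V ((1 : B) ⊗ₜ[ℂ] E (j • p) h))
    (fun j => LieModule.toEnd ℂ (B ⊗[ℂ] τ) V (b ⊗ₜ[ℂ] E (s - j • p) h))
    (fun j => LieModule.toEnd ℂ (B ⊗[ℂ] τ) V (b ⊗ₜ[ℂ] K (s + j • p) i))
    (intWeight n p) (intWeight n s)
    (fun j => by rw [← map_zsmul (intWeight n)]; exact hasDeg_E hτ _ _ _)
    (fun j => by rw [← map_zsmul (intWeight n), ← map_sub (intWeight n)]; exact hasDeg_E hτ _ _ _)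
    (fun j => by rw [← map_zsmul (intWeight n), ← map_add (intWeight n)]; exact hasDeg_K hτ _ _ _)
    (κ h h) hh
    (fun j l => by
      rw [← toEnd_lie, tmul_lie_tmul, hτ.lie_E_E, lie_self, map_zero,
        zero_add, one_mul, ← map_smul (LieModule.toEnd ℂ (B ⊗[ℂ] τ) V),
        ← TensorProduct.tmul_smul, mul_smul, Finset.sum_eq_single i]
      · congr 5
        · simp [hp]
        · rw [sub_smul]
          abel_nf
      · intro q _ hq
        simp [hp, hq]
      · simp)
    (fun j l => toEnd_commute _ _ (by
      rw [tmul_lie_tmul, ← lie_skew, hτ.lie_E_K, neg_zero, TensorProduct.tmul_zero]))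
    (fun j l => toEnd_commute _ _ (by
      rw [tmul_lie_tmul, ← lie_skew, hτ.lie_E_K, neg_zero, TensorProduct.tmul_zero]))
    (fun j l => toEnd_commute _ _ (kernelGens_lie_kernelGens hτ _ _ _ _ _ _))
    (fun j => locNil_or_injective hirr _ (kernelGens_lie_lie hτ _ _ _))
  simpa using key

end Toroidal

theorem statement_5
    (n : ℕ) (hn : 3 ≤ n)
    (𝔤 : Type) [LieRing 𝔤] [LieAlgebra ℂ 𝔤] [LieAlgebra.IsSimple ℂ 𝔤]
    [FiniteDimensional ℂ 𝔤]
    (τ : Type) [LieRing τ] [LieAlgebra ℂ τ]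
    (κ : 𝔤 →ₗ[ℂ] 𝔤 →ₗ[ℂ] ℂ) (c₁ c₂ : ℂ)
    (E : (Fin n → ℤ) → 𝔤 →ₗ[ℂ] τ) (K W : (Fin n → ℤ) → Fin n → τ)
    (hτ : IsFullToroidal n 𝔤 τ κ c₁ c₂ E K W)
    (B : Type) [CommRing B] [Algebra ℂ B] [Nontrivial B]
    (hB : Algebra.FiniteType ℂ B)
    (V : Type) [AddCommGroup V] [Module ℂ V]
    [LieRingModule (B ⊗[ℂ] τ) V] [LieModule ℂ (B ⊗[ℂ] τ) V]
    (hirr : LieModule.IsIrreducible ℂ (B ⊗[ℂ] τ) V)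
    (hcusp : IsCuspidal (V := V) (dOp B W))
 :
    ∀ (m : Fin n → ℤ) (i : Fin n) (a : B) (v : V), ⁅a ⊗ₜ[ℂ] K m i, v⁆ = 0 := by
  obtain ⟨⟨hsup, hfin⟩, N, hN⟩ := hcusp
  have : Nontrivial 𝔤 := by
    by_contra hcon
    rw [not_nontrivial_iff_subsingleton] at hcon
    exact LieAlgebra.IsSimple.non_abelian ℂ (L := 𝔤) ⟨fun x y => Subsingleton.elim _ _⟩
  have hV : Nontrivial V := (LieSubmodule.nontrivial_iff ℂ (B ⊗[ℂ] τ) V).1 hirr.toNontrivial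
  have hne : ∃ l, weightSpace (V := V) (dOp B W) l ≠ ⊥ := by
    by_contra! hcon
    simp [hcon] at hsup
  obtain ⟨v₀, hv₀, hkill⟩ := exists_null_vector hn (weightSpace (V := V) (dOp B W)) N hfin hN hne
    (intWeight n) (fun m i (b : B) => LieModule.toEnd ℂ (B ⊗[ℂ] τ) V (b ⊗ₜ[ℂ] K m i))
    (fun m i => LieModule.toEnd ℂ (B ⊗[ℂ] τ) V ((1 : B) ⊗ₜ[ℂ] W m i))
    (fun m i b => hasDeg_K hτ b m i) (fun m i => hasDeg_W hτ 1 m i)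
    (fun m i b m' i' b' => toEnd_commute _ _ (kernelGens_lie_kernelGens hτ _ _ _ _ _ _))
    (fun m i q j b hij => by
      rw [← toEnd_lie, tmul_lie_tmul, hτ.lie_W_K, if_neg hij, add_zero,
        one_mul, TensorProduct.tmul_smul, map_smul])
    (fun m i b => locNil_kernelGens hτ hirr N hfin hN hne m i b)
  intro m i a v
  exact lie_eq_zero_of_exists hirr (kernelGens B K) (lie_mem_span_kernelGens hτ)
    ⟨v₀, hv₀, by rintro _ ⟨a, m, i, rfl⟩; exact hkill m i a⟩ _ ⟨a, m, i, rfl⟩ v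

end MT
end

section
/- Let V be an irreducible cuspidal Harish-Chandra module over τ(B). Then for each 1 ≤ i ≤ n there exists N ∈ ℕ such that for all a_1,…,a_{3N} ∈ B and all m^{(1)},…,m^{(3N)} ∈ ℤ^n one has (t^{m^{(1)}}K_i ⊗ a_1)(t^{m^{(2)}}K_i ⊗ a_2)⋯(t^{m^{(3N)}}K_i ⊗ a_{3N})·V = 0 (composition of the module actions). -/
open scoped TensorProduct

namespace MT

variable {n : ℕ} {𝔤 : Type} [LieRing 𝔤] [LieAlgebra ℂ 𝔤]
variable {τ : Type} [LieRing τ] [LieAlgebra ℂ τ]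

/-- If `x ^ a * y = 0` then some powers of `D x` and `y` have product zero. -/
theorem exists_derivation_pow_mul_pow_eq_zero {R : Type*} [CommRing R] [Algebra ℂ R]
    (D : Derivation ℂ R R) (x : R) (a : ℕ) :
    ∀ y : R, x ^ a * y = 0 → ∃ s t : ℕ, D x ^ s * y ^ t = 0 := by
  induction a with
  | zero => exact fun y h => ⟨0, 1, by simpa using h⟩
  | succ a ih =>
    intro y h
    have h₁ : x ^ a * (D x * y ^ 2) = 0 := by
      have h₂ := congrArg (fun z => y * D z) h
      simp only [Derivation.leibniz, Derivation.leibniz_pow, smul_eq_mul, map_zero,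
        mul_zero, Nat.add_sub_cancel, nsmul_eq_mul] at h₂
      have h₃ : ((a + 1 : ℕ) : ℂ) • (x ^ a * (D x * y ^ 2)) = 0 := by
        rw [Nat.cast_smul_eq_nsmul, nsmul_eq_mul]
        linear_combination h₂ - D y * h
      exact (smul_eq_zero.1 h₃).resolve_left (Nat.cast_ne_zero.2 a.succ_ne_zero)
    obtain ⟨s, t, hst⟩ := ih _ h₁
    exact ⟨s + t, 2 * t, by rw [← hst]; ring⟩

theorem isNilpotent_derivation_apply_mul {R : Type*} [CommRing R] [Algebra ℂ R]
    (D : Derivation ℂ R R) {x y : R} (h : IsNilpotent (x * y)) : IsNilpotent (D x * y) := by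
  obtain ⟨N, hN⟩ := h
  rw [mul_pow] at hN
  obtain ⟨s, t, hst⟩ := exists_derivation_pow_mul_pow_eq_zero D x N _ hN
  refine ⟨s + N * t, ?_⟩
  calc (D x * y) ^ (s + N * t) = (D x ^ s * (y ^ N) ^ t) * (D x ^ (N * t) * y ^ s) := by ring
    _ = 0 := by rw [hst, zero_mul]

/-- Polarization of `x ^ L = 0` along derivations. -/
theorem pow_mul_eq_zero_of_mem_pow {R ι : Type*} [CommRing R] [Algebra ℂ R]
    (D : ι → Derivation ℂ R R) (M : Submodule ℂ R) (hM : ∀ i, ∀ y ∈ M, D i y ∈ M) (x : R)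
    (hx : M ≤ Submodule.span ℂ (Set.range fun i => D i x)) (L : ℕ) (hL : x ^ L = 0) :
    ∀ s t : ℕ, s + t = L → ∀ y ∈ M ^ t, x ^ s * y = 0 := by
  have hpow : ∀ (t : ℕ) (i : ι), ∀ y ∈ M ^ t, D i y ∈ M ^ t := by
    intro t i
    induction t with
    | zero =>
      intro y hy
      obtain ⟨c, rfl⟩ := Submodule.mem_one.1 (by simpa using hy)
      simp
    | succ t ih =>
      intro y hy
      rw [pow_succ] at hy ⊢
      induction hy using Submodule.mul_induction_on' with
      | mem_mul_mem a ha b hb =>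
        rw [Derivation.leibniz, smul_eq_mul, smul_eq_mul, mul_comm b]
        exact add_mem (Submodule.mul_mem_mul ha (hM i b hb)) (Submodule.mul_mem_mul (ih a ha) hb)
      | add a _ b _ ha hb => rw [map_add]; exact add_mem ha hb
  intro s t
  induction t generalizing s with
  | zero =>
    rintro rfl y -
    rw [show x ^ s = 0 from hL, zero_mul]
  | succ t ih =>
    intro hst y hy
    have ih' := ih (s + 1) (by omega)
    rw [pow_succ] at hy
    induction hy using Submodule.mul_induction_on' with
    | mem_mul_mem a ha b hb =>
      have hb' := hx hb
      clear hb
      induction hb' using Submodule.span_induction with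
      | mem z hz =>
        obtain ⟨i, rfl⟩ := hz
        have h₂ := congrArg (D i) (ih' a ha)
        have h₄ := ih' _ (hpow t i a ha)
        simp only [Derivation.leibniz, Derivation.leibniz_pow, smul_eq_mul, map_zero,
          Nat.add_sub_cancel, nsmul_eq_mul] at h₂
        have h₃ : ((s + 1 : ℕ) : ℂ) • (x ^ s * (a * D i x)) = 0 := by
          rw [Nat.cast_smul_eq_nsmul, nsmul_eq_mul]
          linear_combination h₂ - h₄
        exact (smul_eq_zero.1 h₃).resolve_left (Nat.cast_ne_zero.2 s.succ_ne_zero)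
      | zero => simp
      | add u v _ _ hu hv => rw [mul_add, mul_add, hu, hv, add_zero]
      | smul c u _ hu => rw [mul_smul_comm, mul_smul_comm, hu, smul_zero]
    | add a _ b _ ha hb => rw [mul_add, ha, hb, add_zero]

theorem mul_aeval_sub_aeval_mul {A : Type*} [Ring A] [Algebra ℂ A] (X h : A)
    (hc : Commute (X * h - h * X) h) (p : Polynomial ℂ) :
    X * Polynomial.aeval h p - Polynomial.aeval h p * X
      = Polynomial.aeval h (Polynomial.derivative p) * (X * h - h * X) := by
  induction p using Polynomial.induction_on' with
  | add p q hp hq =>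
    simp only [map_add, add_mul, mul_add, ← hp, ← hq]; abel
  | monomial k c =>
    have key : X * h ^ k - h ^ k * X = (k : ℂ) • (h ^ (k - 1) * (X * h - h * X)) := by
      induction k with
      | zero => simp
      | succ k ih =>
        have e : X * h ^ (k + 1) - h ^ (k + 1) * X
            = (X * h ^ k - h ^ k * X) * h + h ^ k * (X * h - h * X) := by
          rw [pow_succ]; noncomm_ring
        rw [e, ih, smul_mul_assoc, mul_assoc, hc.eq, ← mul_assoc]
        rcases k with _ | k
        · simp
        · rw [Nat.add_sub_cancel, ← pow_succ, Nat.add_sub_cancel]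
          rw [Nat.cast_succ (k + 1), Nat.cast_succ k, add_smul (_ + 1) (1 : ℂ), add_smul _ (1 : ℂ),
            one_smul]
    rw [Polynomial.derivative_monomial, Polynomial.aeval_monomial, Polynomial.aeval_monomial,
      map_mul, mul_assoc, mul_assoc, mul_assoc, ← mul_assoc X, ← Algebra.commutes c X, mul_assoc,
      ← mul_sub, key]
    simp [Algebra.smul_def]

/-- A commutator on a finite-dimensional space that commutes with one of its two arguments is
nilpotent. -/
theorem commutator_pow_eq_zero {U : Type*} [AddCommGroup U] [Module ℂ U] [FiniteDimensional ℂ U]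
    (X h : Module.End ℂ U) (hc : Commute (X * h - h * X) h) :
    (X * h - h * X) ^ (2 ^ Module.finrank ℂ U) = 0 := by
  set C := X * h - h * X with hC
  have key : ∀ k : ℕ,
      Polynomial.aeval h (Polynomial.derivative^[k] h.charpoly) * C ^ (2 ^ k - 1) = 0 := by
    intro k
    induction k with
    | zero => simp [LinearMap.aeval_self_charpoly]
    | succ k ih =>
      have hd := mul_aeval_sub_aeval_mul X h hc (Polynomial.derivative^[k] h.charpoly)
      rw [← hC, ← Function.iterate_succ_apply' Polynomial.derivative] at hd
      have hcomm : ∀ p : Polynomial ℂ, Commute C (Polynomial.aeval h p) := fun p =>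
        Algebra.commute_of_mem_adjoin_singleton_of_commute
          (Polynomial.aeval_mem_adjoin_singleton ℂ h) hc
      have hr : 2 ^ (k + 1) - 1 = (2 ^ k - 1) + (1 + (2 ^ k - 1)) := by
        have := Nat.one_le_two_pow (n := k)
        rw [pow_succ]; omega
      set r := 2 ^ k - 1
      rw [hr, pow_add, ← mul_assoc, ← ((hcomm _).pow_left r).eq, pow_add, pow_one, mul_assoc,
        ← mul_assoc _ C, ← hd, sub_mul, mul_assoc X, ih, mul_zero, zero_sub, mul_neg, mul_assoc,
        ← mul_assoc, ((hcomm _).pow_left r).eq, ih, zero_mul, neg_zero]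
  have hlast := key (Module.finrank ℂ U)
  have hdeg := LinearMap.charpoly_natDegree h
  have hconst : Polynomial.derivative^[Module.finrank ℂ U] h.charpoly
      = Polynomial.C ((Module.finrank ℂ U).factorial : ℂ) := by
    rw [Polynomial.eq_C_of_natDegree_le_zero (p := Polynomial.derivative^[_] _)
      ((Polynomial.natDegree_iterate_derivative _ _).trans (by rw [hdeg, Nat.sub_self])),
      Polynomial.coeff_iterate_derivative, zero_add, Nat.descFactorial_self, ← hdeg,
      Polynomial.coeff_natDegree, h.charpoly_monic.leadingCoeff]
    simp
  rw [hconst, Polynomial.aeval_C, ← Algebra.smul_def] at hlast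
  have h0 := (smul_eq_zero.1 hlast).resolve_left (Nat.cast_ne_zero.2 (Nat.factorial_ne_zero _))
  exact pow_eq_zero_of_le (Nat.sub_le _ _) h0

theorem list_prod_mem_submodule_pow {R : Type*} [CommRing R] [Algebra ℂ R] (M : Submodule ℂ R)
    (l : List R) (h : ∀ x ∈ l, x ∈ M) : l.prod ∈ M ^ l.length := by
  induction l with
  | nil => exact Submodule.one_le.1 (by simp)
  | cons a l ih =>
    rw [List.prod_cons, List.length_cons, pow_succ']
    exact Submodule.mul_mem_mul (h a (by simp)) (ih fun x hx => h x (by simp [hx]))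

/-- If a family behaving like functions on a torus under the derivations `t^m d_j` contains
three elements of nonzero `j`-degree with nilpotent product, then the family generates a
nilpotent ideal. -/
theorem exists_prod_eq_zero_of_derivation {n : ℕ} {B R : Type*} [CommRing B] [CommRing R]
    [Algebra ℂ R] (j : Fin n) (f : (Fin n → ℤ) → B → R)
    (D : (Fin n → ℤ) → B → Derivation ℂ R R)
    (hD : ∀ m b k a, D m b (f k a) = (k j : ℂ) • f (m + k) (b * a))
    {p q r : Fin n → ℤ} (hp : p j ≠ 0) (hq : q j ≠ 0) (hr : r j ≠ 0)
    (h : IsNilpotent (f p 1 * f q 1 * f r 1)) :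
    ∃ N : ℕ, ∀ l : List ((Fin n → ℤ) × B), l.length = 3 * N →
      (l.map fun x => f x.1 x.2).prod = 0 := by
  have hf : ∀ k, k j ≠ 0 → ∀ m a, f m a = (k j : ℂ)⁻¹ • D (m - k) a (f k 1) := by
    intro k hk m a
    rw [hD, mul_one, sub_add_cancel, inv_smul_smul₀ (Int.cast_ne_zero.2 hk)]
  have step : ∀ k, k j ≠ 0 → ∀ y, IsNilpotent (f k 1 * y) → IsNilpotent (f p 1 * y) := by
    intro k hk y hy
    rw [hf k hk p 1, smul_mul_assoc]
    exact (isNilpotent_derivation_apply_mul (D (p - k) 1) hy).smul _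
  have h₁ : IsNilpotent (f p 1 * (f p 1 * f p 1)) := by
    rw [mul_comm] at h
    have h₂ := step r hr _ h
    rw [show f p 1 * (f p 1 * f q 1) = f q 1 * (f p 1 * f p 1) by ring] at h₂
    exact step q hq _ h₂
  obtain ⟨N, hN⟩ := h₁
  refine ⟨N, fun l hl => ?_⟩
  set M : Submodule ℂ R := Submodule.span ℂ (Set.range fun x : (Fin n → ℤ) × B => f x.1 x.2)
  have hfM : ∀ k a, f k a ∈ M := fun k a => Submodule.subset_span ⟨(k, a), rfl⟩
  have hz := pow_mul_eq_zero_of_mem_pow (fun x : (Fin n → ℤ) × B => D x.1 x.2) M ?_ (f p 1) ?_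
    (3 * N) (by rw [pow_mul, ← hN]; ring) 0 (3 * N) (zero_add _)
    (l.map fun x => f x.1 x.2).prod ?_
  · simpa using hz
  · rintro ⟨m, b⟩ y hy
    induction hy using Submodule.span_induction with
    | mem y hy =>
      obtain ⟨x, rfl⟩ := hy
      simp only [hD]
      exact M.smul_mem _ (hfM _ _)
    | zero => simp
    | add u v _ _ hu hv => rw [map_add]; exact add_mem hu hv
    | smul c u _ hu => rw [Derivation.map_smul]; exact M.smul_mem _ hu
  · refine Submodule.span_le.2 ?_
    rintro _ ⟨⟨m, a⟩, rfl⟩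
    simp only [hf p hp m a]
    exact Submodule.smul_mem _ _ (Submodule.subset_span ⟨(m - p, a), rfl⟩)
  · have := list_prod_mem_submodule_pow M (l.map fun x => f x.1 x.2) (by
      intro x hx
      obtain ⟨y, -, rfl⟩ := List.mem_map.1 hx
      exact hfM _ _)
    rwa [List.length_map, hl] at this

open scoped IsMulCommutative in
/-- The inner derivation of `w` on a commutative subalgebra which it normalizes. -/
def innerDerivation {A : Type*} [Ring A] [Algebra ℂ A] (S : Subalgebra ℂ A)
    [IsMulCommutative S] (w : A) (hw : ∀ x ∈ S, w * x - x * w ∈ S) : Derivation ℂ S S :=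
  Derivation.mk'
    { toFun := fun x => ⟨w * x - x * w, hw x x.2⟩
      map_add' := fun x y => Subtype.ext (by
        simp only [AddMemClass.coe_add, mul_add, add_mul]; abel)
      map_smul' := fun c x => Subtype.ext (by simp [smul_sub]) }
    (fun x y => by
      rw [smul_eq_mul, smul_eq_mul, mul_comm y]
      refine Subtype.ext ?_
      simp only [LinearMap.coe_mk, AddHom.coe_mk, Subalgebra.coe_mul, Subalgebra.coe_add]
      noncomm_ring)

theorem exists_prod_eq_zero_of_commutator {n : ℕ} {B A : Type*} [CommRing B] [Ring A]
    [Algebra ℂ A] (j : Fin n) (F w : (Fin n → ℤ) → B → A)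
    (hFF : ∀ k a m b, F k a * F m b = F m b * F k a)
    (hwF : ∀ m b k a, w m b * F k a - F k a * w m b = (k j : ℂ) • F (m + k) (b * a))
    {p q r : Fin n → ℤ} (hp : p j ≠ 0) (hq : q j ≠ 0) (hr : r j ≠ 0)
    (h : IsNilpotent (F p 1 * F q 1 * F r 1)) :
    ∃ N : ℕ, ∀ l : List ((Fin n → ℤ) × B), l.length = 3 * N →
      (l.map fun x => F x.1 x.2).prod = 0 := by
  set S := Algebra.adjoin ℂ (Set.range fun x : (Fin n → ℤ) × B => F x.1 x.2)
  have hS : IsMulCommutative S := Algebra.isMulCommutative_adjoin ℂ (by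
    rintro _ ⟨x, rfl⟩ _ ⟨y, rfl⟩
    exact hFF _ _ _ _)
  have hFS : ∀ k a, F k a ∈ S := fun k a => Algebra.subset_adjoin ⟨(k, a), rfl⟩
  have hwS : ∀ m b, ∀ x ∈ S, w m b * x - x * w m b ∈ S := by
    intro m b x hx
    induction hx using Algebra.adjoin_induction with
    | mem x hx =>
      obtain ⟨y, rfl⟩ := hx
      simp only [hwF]
      exact S.smul_mem (hFS _ _) _
    | algebraMap c => rw [Algebra.commutes, sub_self]; exact S.zero_mem
    | add x y _ _ hx hy =>
      convert add_mem hx hy using 1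
      noncomm_ring
    | mul x y hx' hy' hx hy =>
      convert add_mem (mul_mem hx hy') (mul_mem hx' hy) using 1
      noncomm_ring
  open scoped IsMulCommutative in
  obtain ⟨N, hN⟩ := exists_prod_eq_zero_of_derivation (R := S) j (fun k a => ⟨F k a, hFS k a⟩)
    (fun m b => innerDerivation S (w m b) (hwS m b))
    (fun m b k a => Subtype.ext (hwF m b k a)) hp hq hr (by
      obtain ⟨N, hN⟩ := h
      exact ⟨N, Subtype.ext hN⟩)
  refine ⟨N, fun l hl => ?_⟩
  have := congrArg S.val (hN l hl)
  rwa [map_list_prod, List.map_map, map_zero] at this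

/-- An element of degree `m` shifts weight spaces by `m`. -/
theorem lie_mem_weightSpace_add {n : ℕ} {L V : Type*} [LieRing L] [LieAlgebra ℂ L]
    [AddCommGroup V] [Module ℂ V] [LieRingModule L V] [LieModule ℂ L V] {d : Fin n → L}
    {l : Fin n → ℂ} {m : Fin n → ℤ} {Y : L} (hY : ∀ i, ⁅d i, Y⁆ = (m i : ℂ) • Y) {v : V}
    (hv : v ∈ weightSpace (V := V) d l) :
    ⁅Y, v⁆ ∈ weightSpace (V := V) d (l + fun i => (m i : ℂ)) := by
  intro i
  rw [leibniz_lie, hY, hv i, smul_lie, lie_smul, ← add_smul, add_comm, Pi.add_apply]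

/-- A commutator of two operators of degree zero on a cuspidal module is nilpotent if it commutes
with the second one. -/
theorem IsCuspidal.isNilpotent_commutator {n : ℕ} {L V : Type*} [LieRing L] [LieAlgebra ℂ L]
    [AddCommGroup V] [Module ℂ V] [LieRingModule L V] [LieModule ℂ L V] {d : Fin n → L}
    (hcusp : IsCuspidal (V := V) d) (X h : Module.End ℂ V)
    (hX : ∀ l, ∀ v ∈ weightSpace (V := V) d l, X v ∈ weightSpace (V := V) d l)
    (hh : ∀ l, ∀ v ∈ weightSpace (V := V) d l, h v ∈ weightSpace (V := V) d l)
    (hc : Commute (X * h - h * X) h) : IsNilpotent (X * h - h * X) := by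
  obtain ⟨⟨htop, hfin⟩, N, hN⟩ := hcusp
  refine ⟨2 ^ N, ?_⟩
  suffices hker : ⊤ ≤ LinearMap.ker ((X * h - h * X) ^ 2 ^ N) by
    rwa [top_le_iff, LinearMap.ker_eq_top] at hker
  rw [← htop]
  refine iSup_le fun l v hv => ?_
  have := hfin l
  set C := X * h - h * X with hC
  have hCl : ∀ u ∈ weightSpace (V := V) d l, C u ∈ weightSpace (V := V) d l := fun u hu =>
    sub_mem (hX l _ (hh l u hu)) (hh l _ (hX l u hu))
  have hres : (X.restrict (hX l)) * (h.restrict (hh l)) - (h.restrict (hh l)) * (X.restrict (hX l))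
      = C.restrict hCl := rfl
  have hpow := commutator_pow_eq_zero (X.restrict (hX l)) (h.restrict (hh l)) (by
    rw [hres]
    exact LinearMap.ext fun u => Subtype.ext (LinearMap.congr_fun hc.eq u))
  rw [hres] at hpow
  have hpow' := pow_eq_zero_of_le (Nat.pow_le_pow_right two_pos (hN l)) hpow
  rw [Module.End.pow_restrict] at hpow'
  exact congrArg Subtype.val (LinearMap.congr_fun hpow' ⟨v, hv⟩)

theorem actList_eq_prod_toEnd {L V : Type*} [LieRing L] [LieAlgebra ℂ L] [AddCommGroup V]
    [Module ℂ V] [LieRingModule L V] [LieModule ℂ L V] (l : List L) (v : V) :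
    actList l v = (l.map (LieModule.toEnd ℂ L V)).prod v := by
  induction l with
  | nil => rfl
  | cons x l ih => simp [actList, ih]

/-- The element `t^{e_i} K_i` vanishes. -/
theorem IsFullToroidal.K_single_eq_zero {n : ℕ} {𝔤 : Type} [LieRing 𝔤] [LieAlgebra ℂ 𝔤]
    {τ : Type} [LieRing τ] [LieAlgebra ℂ τ] {κ : 𝔤 →ₗ[ℂ] 𝔤 →ₗ[ℂ] ℂ} {c₁ c₂ : ℂ}
    {E : (Fin n → ℤ) → 𝔤 →ₗ[ℂ] τ} {K W : (Fin n → ℤ) → Fin n → τ}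
    (hτ : IsFullToroidal n 𝔤 τ κ c₁ c₂ E K W) (i : Fin n) : K (Pi.single i 1) i = 0 := by
  have h := hτ.K_rel (Pi.single i 1)
  rwa [Finset.sum_eq_single i (fun k _ hk => by simp [Pi.single_eq_of_ne hk]) (by simp),
    Pi.single_eq_same, Int.cast_one, one_smul] at h

theorem statement_6
    (n : ℕ) (hn : 3 ≤ n)
    (𝔤 : Type) [LieRing 𝔤] [LieAlgebra ℂ 𝔤] [LieAlgebra.IsSimple ℂ 𝔤]
    [FiniteDimensional ℂ 𝔤]
    (τ : Type) [LieRing τ] [LieAlgebra ℂ τ]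
    (κ : 𝔤 →ₗ[ℂ] 𝔤 →ₗ[ℂ] ℂ) (c₁ c₂ : ℂ)
    (E : (Fin n → ℤ) → 𝔤 →ₗ[ℂ] τ) (K W : (Fin n → ℤ) → Fin n → τ)
    (hτ : IsFullToroidal n 𝔤 τ κ c₁ c₂ E K W)
    (B : Type) [CommRing B] [Algebra ℂ B] [Nontrivial B]
    (hB : Algebra.FiniteType ℂ B)
    (V : Type) [AddCommGroup V] [Module ℂ V]
    [LieRingModule (B ⊗[ℂ] τ) V] [LieModule ℂ (B ⊗[ℂ] τ) V]
    (hirr : LieModule.IsIrreducible ℂ (B ⊗[ℂ] τ) V)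
    (hcusp : IsCuspidal (V := V) (dOp B W))
 :
    ∀ i : Fin n, ∃ N : ℕ,
      ∀ (a : Fin (3 * N) → B) (ms : Fin (3 * N) → (Fin n → ℤ)) (v : V),
        actList (List.ofFn fun j => a j ⊗ₜ[ℂ] K (ms j) i) v = 0 := by
  intro i
  obtain ⟨j, hj⟩ : ∃ j : Fin n, j ≠ i := by
    have : Nontrivial (Fin n) := Fin.nontrivial_iff_two_le.2 (by omega)
    exact exists_ne i
  set ρ := LieModule.toEnd ℂ (B ⊗[ℂ] τ) V
  set F : (Fin n → ℤ) → B → Module.End ℂ V := fun k a => ρ (a ⊗ₜ[ℂ] K k i) with hF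
  set w : (Fin n → ℤ) → B → Module.End ℂ V := fun m b => ρ (b ⊗ₜ[ℂ] W m j) with hw
  have hρ : ∀ x y, ρ x * ρ y - ρ y * ρ x = ρ ⁅x, y⁆ := fun x y =>
    LinearMap.ext fun v => (lie_lie x y v).symm
  have hFF : ∀ k a m b, F k a * F m b = F m b * F k a := by
    intro k a m b
    rw [← sub_eq_zero, hF, hρ, LieAlgebra.ExtendScalars.bracket_tmul, hτ.lie_K_K, TensorProduct.tmul_zero, map_zero]
  have hwF : ∀ m b k a, w m b * F k a - F k a * w m b = (k j : ℂ) • F (m + k) (b * a) := by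
    intro m b k a
    rw [hF, hw, hρ, LieAlgebra.ExtendScalars.bracket_tmul,
      hτ.lie_W_K, if_neg hj, add_zero, TensorProduct.tmul_smul, map_smul]
  have hFwt : ∀ k a l, ∀ v ∈ weightSpace (V := V) (dOp B W) l,
      F k a v ∈ weightSpace (V := V) (dOp B W) (l + fun i => (k i : ℂ)) := by
    intro k a l v hv
    refine lie_mem_weightSpace_add (fun i' => ?_) hv
    rw [dOp, LieAlgebra.ExtendScalars.bracket_tmul, hτ.lie_W_K]
    simp
  have hwwt : ∀ m b l, ∀ v ∈ weightSpace (V := V) (dOp B W) l,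
      w m b v ∈ weightSpace (V := V) (dOp B W) (l + fun i => (m i : ℂ)) := by
    intro k a l v hv
    refine lie_mem_weightSpace_add (fun i' => ?_) hv
    rw [dOp, LieAlgebra.ExtendScalars.bracket_tmul, hτ.lie_W_W]
    simp
  set k : Fin n → ℤ := Pi.single j 1
  set e : Fin n → ℤ := Pi.single i 1
  have hkj : k j = 1 := Pi.single_eq_same j 1
  have hej : e j = 0 := Pi.single_eq_of_ne hj 1
  have hFe : ∀ a, F e a = 0 := fun a => by
    simp only [hF, e, hτ.K_single_eq_zero i, TensorProduct.tmul_zero, map_zero]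
  have hcomm : (F (-(k + e)) 1 * w (k + e) 1) * (F k 1 * F (-k) 1)
        - (F k 1 * F (-k) 1) * (F (-(k + e)) 1 * w (k + e) 1)
      = F (-(k + e)) 1 * F (k + e + k) 1 * F (-k) 1 := by
    have h₁ := hwF (k + e) 1 k 1
    have h₂ := hwF (k + e) 1 (-k) 1
    rw [show k + e + -k = e by abel, hFe, smul_zero, sub_eq_zero] at h₂
    rw [hkj, Int.cast_one, one_smul, mul_one] at h₁
    have h₃ : (F k 1 * F (-k) 1) * F (-(k + e)) 1 = F (-(k + e)) 1 * (F k 1 * F (-k) 1) := by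
      rw [mul_assoc, hFF (-k), ← mul_assoc, hFF k, mul_assoc]
    rw [← mul_assoc (F k 1 * F (-k) 1), h₃, ← h₁]
    simp only [mul_assoc, sub_mul, mul_sub, h₂]
  have hneg : ∀ m : Fin n → ℤ,
      ((fun i => (m i : ℂ)) + fun i => (((-m) i : ℤ) : ℂ)) = 0 := fun m => by
    funext x
    simp
  have hnil := hcusp.isNilpotent_commutator (F (-(k + e)) 1 * w (k + e) 1) (F k 1 * F (-k) 1)
    (fun l v hv => by
      have := hFwt (-(k + e)) 1 _ _ (hwwt (k + e) 1 l v hv)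
      rwa [add_assoc, hneg, add_zero] at this)
    (fun l v hv => by
      have := hFwt k 1 _ _ (hFwt (-k) 1 l v hv)
      rwa [add_right_comm, add_assoc, hneg, add_zero] at this)
    (by
      have hall : ∀ p q, Commute (F p 1) (F q 1) := fun p q => hFF p 1 q 1
      rw [hcomm]
      exact (((hall _ _).mul_right (hall _ _)).mul_left ((hall _ _).mul_right (hall _ _))).mul_left
        ((hall _ _).mul_right (hall _ _)))
  rw [hcomm] at hnil
  obtain ⟨N, hN⟩ := exists_prod_eq_zero_of_commutator j F w hFF hwF
    (by simp [hkj, hej]) (by simp [hkj, hej]) (by simp [hkj]) hnil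
  refine ⟨N, fun a ms v => ?_⟩
  have := hN (List.ofFn fun x => (ms x, a x)) (List.length_ofFn)
  rw [List.map_ofFn] at this
  rw [actList_eq_prod_toEnd, List.map_ofFn]
  exact LinearMap.congr_fun this v

end MT
end

section
/- Let V be an irreducible cuspidal Harish-Chandra module over τ(B). Then there exists a cofinite ideal J of B (i.e. dim_ℂ B/J < ∞) such that (τ ⊗ J)·V = 0. -/
open scoped TensorProduct

namespace MT

variable {n : ℕ} {𝔤 : Type} [LieRing 𝔤] [LieAlgebra ℂ 𝔤]
variable {τ : Type} [LieRing τ] [LieAlgebra ℂ τ]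

section CofiniteIdeals

variable {R : Type*} [CommRing R] [Algebra ℂ R]

lemma pow_finrank_eq_bot_of_pow_eq_bot [FiniteDimensional ℂ R] {I : Ideal R} {r : ℕ}
    (h : I ^ r = ⊥) : I ^ Module.finrank ℂ R = ⊥ := by
  have key : ∀ i : ℕ, I ^ i = ⊥ ∨
      Module.finrank ℂ ((I ^ i).restrictScalars ℂ) + i ≤ Module.finrank ℂ R := by
    intro i
    induction i with
    | zero => exact Or.inr (by simpa using Submodule.finrank_le _)
    | succ i ih =>
      by_cases hi : I ^ i = ⊥
      · left
        rw [pow_succ, hi, Ideal.bot_mul]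
      have ih := ih.resolve_left hi
      have hle : I ^ (i + 1) ≤ I ^ i := Ideal.pow_le_pow_right i.le_succ
      rcases hle.lt_or_eq with hlt | heq
      · right
        have hlt' : (I ^ (i + 1)).restrictScalars ℂ < (I ^ i).restrictScalars ℂ := hlt
        have := Submodule.finrank_lt_finrank_of_lt hlt'
        omega
      · exfalso
        have stable : ∀ j : ℕ, I ^ (i + j) = I ^ i := by
          intro j
          induction j with
          | zero => rfl
          | succ j ihj => rw [← add_assoc, pow_succ, ihj, ← pow_succ, heq]
        apply hi
        rw [← stable r, pow_add, h, Ideal.mul_bot]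
  rcases key (Module.finrank ℂ R) with h' | h'
  · exact h'
  · have h0 : Module.finrank ℂ ((I ^ Module.finrank ℂ R).restrictScalars ℂ) = 0 := by omega
    rw [Submodule.finrank_eq_zero] at h0
    exact (Submodule.restrictScalars_eq_bot_iff ℂ R R).1 h0

/-- If some power of `J` lies in a cofinite ideal `P`, then so does the power whose exponent is
any bound on the codimension of `P`. -/
lemma pow_le_of_finrank_quotient_le {J P : Ideal R} [FiniteDimensional ℂ (R ⧸ P)] {C r : ℕ}
    (hC : Module.finrank ℂ (R ⧸ P) ≤ C) (h : J ^ r ≤ P) : J ^ C ≤ P := by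
  have h1 : (J.map (Ideal.Quotient.mk P)) ^ r = ⊥ := by
    rw [← Ideal.map_pow, Ideal.map_eq_bot_iff_le_ker, Ideal.mk_ker]
    exact h
  have h2 := pow_finrank_eq_bot_of_pow_eq_bot h1
  rw [← Ideal.map_pow, Ideal.map_eq_bot_iff_le_ker, Ideal.mk_ker] at h2
  exact (Ideal.pow_le_pow_right hC).trans h2

lemma finiteDimensional_quotient_pow [IsNoetherianRing R] (J : Ideal R)
    [FiniteDimensional ℂ (R ⧸ J)] (k : ℕ) : FiniteDimensional ℂ (R ⧸ J ^ k) := by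
  rcases Nat.eq_zero_or_pos k with rfl | hk
  · rw [pow_zero, Ideal.one_eq_top]
    infer_instance
  have hle : J ^ k ≤ J := Ideal.pow_le_self hk.ne'
  refine Module.finite_of_surjective_of_ker_le_nilradical (Ideal.Quotient.factorₐ ℂ hle)
    (Ideal.Quotient.factor_surjective hle) ?_ (IsNoetherian.noetherian _)
  intro x hx
  obtain ⟨b, rfl⟩ := Ideal.Quotient.mk_surjective x
  have hb : b ∈ J := by
    rw [RingHom.mem_ker] at hx
    exact Ideal.Quotient.eq_zero_iff_mem.1 hx
  refine ⟨k, ?_⟩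
  rw [← map_pow]
  exact Ideal.Quotient.eq_zero_iff_mem.2 (Ideal.pow_mem_pow hb k)

lemma finiteDimensional_quotient_iff_cofg (J : Ideal R) :
    FiniteDimensional ℂ (R ⧸ J) ↔ (J.restrictScalars ℂ).CoFG :=
  Module.Finite.equiv_iff (Submodule.Quotient.restrictScalarsEquiv ℂ J).symm

lemma finiteDimensional_quotient_finset_inf {ι : Type*} (s : Finset ι) (P : ι → Ideal R)
    (h : ∀ i ∈ s, FiniteDimensional ℂ (R ⧸ P i)) : FiniteDimensional ℂ (R ⧸ s.inf P) := by
  classical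
  induction s using Finset.induction_on with
  | empty =>
    rw [Finset.inf_empty]
    infer_instance
  | insert a s ha ih =>
    rw [Finset.inf_insert, finiteDimensional_quotient_iff_cofg]
    have h₁ := (finiteDimensional_quotient_iff_cofg _).1 (h a (Finset.mem_insert_self a s))
    have h₂ := (finiteDimensional_quotient_iff_cofg _).1
      (ih fun i hi => h i (Finset.mem_insert_of_mem hi))
    have hinf : (P a ⊓ s.inf P).restrictScalars ℂ =
        (P a).restrictScalars ℂ ⊓ (s.inf P).restrictScalars ℂ := Submodule.ext fun _ => Iff.rfl
    rw [hinf]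
    exact h₁.inf h₂

lemma finrank_quotient_le_of_mem_iff {M : Type*} [AddCommGroup M] [Module ℂ M]
    [FiniteDimensional ℂ M] (P : Ideal R) (Φ : R →ₗ[ℂ] M) (h : ∀ b, b ∈ P ↔ Φ b = 0) :
    FiniteDimensional ℂ (R ⧸ P) ∧ Module.finrank ℂ (R ⧸ P) ≤ Module.finrank ℂ M := by
  have hker : P.restrictScalars ℂ = LinearMap.ker Φ := Submodule.ext h
  let e : (R ⧸ P) ≃ₗ[ℂ] LinearMap.range Φ :=
    (Submodule.Quotient.restrictScalarsEquiv ℂ P).symm ≪≫ₗ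
      (Submodule.quotEquivOfEq _ _ hker) ≪≫ₗ Φ.quotKerEquivRange
  exact ⟨e.symm.finiteDimensional, e.finrank_eq.trans_le (Submodule.finrank_le _)⟩

end CofiniteIdeals

/-- A subset of `ℤⁿ` closed under sums of two distinct elements and containing the vectors
`±eᵢ`, `±2 eᵢ` is everything. -/
lemma mem_of_add_mem_of_ne {n : ℕ} (hn : 0 < n) (T : Set (Fin n → ℤ))
    (hadd : ∀ m ∈ T, ∀ k ∈ T, m ≠ k → m + k ∈ T)
    (hgen : ∀ i, ∀ c ∈ ({1, -1, 2, -2} : Finset ℤ), Pi.single i c ∈ T) (m : Fin n → ℤ) :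
    m ∈ T := by
  classical
  have add_single : ∀ i (a b : ℤ), a ≠ b → Pi.single i a ∈ T → Pi.single i b ∈ T →
      Pi.single i (a + b) ∈ T := by
    intro i a b hab ha hb
    rw [Pi.single_add]
    exact hadd _ ha _ hb fun h => hab (Pi.single_injective i h)
  have single0 : ∀ i, (Pi.single i (0 : ℤ) : Fin n → ℤ) ∈ T := fun i =>
    add_single i 1 (-1) (by norm_num) (hgen i 1 (by simp)) (hgen i (-1) (by simp))
  have single_mem : ∀ i (a : ℤ), (Pi.single i a : Fin n → ℤ) ∈ T := by
    intro i a
    induction a using Int.induction_on with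
    | zero => exact single0 i
    | succ a ih =>
      by_cases h : (a : ℤ) = 1
      · rw [h]
        exact hgen i 2 (by simp)
      · exact add_single i _ _ h ih (hgen i 1 (by simp))
    | pred a ih =>
      by_cases h : (-(a : ℤ)) = -1
      · rw [h]
        exact hgen i (-2) (by simp)
      · exact add_single i _ _ h ih (hgen i (-1) (by simp))
  have zero_mem : (0 : Fin n → ℤ) ∈ T := by simpa using single0 ⟨0, hn⟩
  have sum_mem : ∀ s : Finset (Fin n), (∑ i ∈ s, Pi.single i (m i) : Fin n → ℤ) ∈ T := by
    intro s
    induction s using Finset.induction_on with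
    | empty => simpa using zero_mem
    | insert a s ha ih =>
      rw [Finset.sum_insert ha]
      by_cases h : (Pi.single a (m a) : Fin n → ℤ) = ∑ i ∈ s, Pi.single i (m i)
      · have h0 : m a = 0 := by
          have := congrFun h a
          rw [Finset.sum_apply, Finset.sum_eq_zero, Pi.single_eq_same] at this
          · exact this
          · intro i hi
            exact Pi.single_eq_of_ne (by rintro rfl; exact ha hi) _
        rw [← h, h0]
        simpa using zero_mem
      · exact hadd _ (single_mem a _) _ ih h
  simpa [Finset.univ_sum_single] using sum_mem Finset.univ

section Generators

variable {κ : 𝔤 →ₗ[ℂ] 𝔤 →ₗ[ℂ] ℂ} {c₁ c₂ : ℂ}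
  {E : (Fin n → ℤ) → 𝔤 →ₗ[ℂ] τ} {K W : (Fin n → ℤ) → Fin n → τ}

lemma E_mem_gradedPiece (m : Fin n → ℤ) (x : 𝔤) : E m x ∈ gradedPiece E K W m :=
  Submodule.subset_span (Or.inl (Or.inl ⟨x, rfl⟩))

lemma K_mem_gradedPiece (m : Fin n → ℤ) (i : Fin n) : K m i ∈ gradedPiece E K W m :=
  Submodule.subset_span (Or.inl (Or.inr ⟨i, rfl⟩))

lemma W_mem_gradedPiece (m : Fin n → ℤ) (i : Fin n) : W m i ∈ gradedPiece E K W m :=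
  Submodule.subset_span (Or.inr ⟨i, rfl⟩)

lemma gradedPiece_le {m : Fin n → ℤ} {S : Submodule ℂ τ} (hE : ∀ x, E m x ∈ S)
    (hK : ∀ i, K m i ∈ S) (hW : ∀ i, W m i ∈ S) : gradedPiece E K W m ≤ S := by
  refine Submodule.span_le.2 ?_
  rintro _ ((⟨x, rfl⟩ | ⟨i, rfl⟩) | ⟨i, rfl⟩)
  exacts [hE x, hK i, hW i]

lemma gradedPiece_finrank_le [FiniteDimensional ℂ 𝔤] (m : Fin n → ℤ) :
    FiniteDimensional ℂ (gradedPiece E K W m) ∧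
      Module.finrank ℂ (gradedPiece E K W m) ≤ Module.finrank ℂ 𝔤 + (n + n) := by
  let f : 𝔤 × (Fin n → ℂ) × (Fin n → ℂ) →ₗ[ℂ] τ :=
    (E m).coprod ((Fintype.linearCombination ℂ (K m)).coprod
      (Fintype.linearCombination ℂ (W m)))
  have hle : gradedPiece E K W m ≤ LinearMap.range f := by
    refine gradedPiece_le (fun x => ⟨(x, 0, 0), ?_⟩) (fun i => ⟨(0, Pi.single i 1, 0), ?_⟩)
      (fun i => ⟨(0, 0, Pi.single i 1), ?_⟩) <;> simp [f]
  refine ⟨Submodule.finiteDimensional_of_le hle, (Submodule.finrank_mono hle).trans ?_⟩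
  refine (LinearMap.finrank_range_le f).trans ?_
  simp

lemma iSup_gradedPiece_eq_top (hτ : IsFullToroidal n 𝔤 τ κ c₁ c₂ E K W) :
    (⨆ m, gradedPiece E K W m) = ⊤ := by
  rw [eq_top_iff, ← hτ.span_eq_top, Submodule.span_le]
  rintro _ ((⟨m, x, rfl⟩ | ⟨m, i, rfl⟩) | ⟨m, i, rfl⟩)
  · exact le_iSup (gradedPiece E K W) m (E_mem_gradedPiece m x)
  · exact le_iSup (gradedPiece E K W) m (K_mem_gradedPiece m i)
  · exact le_iSup (gradedPiece E K W) m (W_mem_gradedPiece m i)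

lemma lie_W_zero (hτ : IsFullToroidal n 𝔤 τ κ c₁ c₂ E K W) {m : Fin n → ℤ} {X : τ}
    (hX : X ∈ gradedPiece E K W m) (i : Fin n) : ⁅W 0 i, X⁆ = (m i : ℂ) • X := by
  let S : Submodule ℂ τ := LinearMap.ker (LieAlgebra.ad ℂ τ (W 0 i) - (m i : ℂ) • LinearMap.id)
  have hS : ∀ Y, Y ∈ S ↔ ⁅W 0 i, Y⁆ = (m i : ℂ) • Y := fun Y => by
    simp [S, LinearMap.mem_ker, sub_eq_zero]
  refine (hS X).1 (gradedPiece_le (fun x => ?_) (fun j => ?_) (fun j => ?_) hX) <;> rw [hS]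
  · simp [hτ.lie_W_E]
  · simp [hτ.lie_W_K]
  · simp [hτ.lie_W_W]

/-- The span of the brackets `[τ_m, τ_k]`. -/
def bracketSpan (E : (Fin n → ℤ) → 𝔤 →ₗ[ℂ] τ) (K W : (Fin n → ℤ) → Fin n → τ)
    (m k : Fin n → ℤ) : Submodule ℂ τ :=
  Submodule.span ℂ {Z | ∃ X ∈ gradedPiece E K W m, ∃ Y ∈ gradedPiece E K W k, ⁅X, Y⁆ = Z}

lemma lie_mem_bracketSpan {m k : Fin n → ℤ} {X Y : τ} (hX : X ∈ gradedPiece E K W m)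
    (hY : Y ∈ gradedPiece E K W k) : ⁅X, Y⁆ ∈ bracketSpan E K W m k :=
  Submodule.subset_span ⟨X, hX, Y, hY, rfl⟩

lemma bracketSpan_le_swap (m k : Fin n → ℤ) :
    bracketSpan E K W m k ≤ bracketSpan E K W k m := by
  refine Submodule.span_le.2 ?_
  rintro _ ⟨X, hX, Y, hY, rfl⟩
  rw [← lie_skew]
  exact Submodule.neg_mem _ (lie_mem_bracketSpan hY hX)

lemma gradedPiece_add_le_bracketSpan_of_ne_zero [Nontrivial 𝔤]
    (hτ : IsFullToroidal n 𝔤 τ κ c₁ c₂ E K W) {m k : Fin n → ℤ} (hmk : m ≠ k) (hk : k ≠ 0) :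
    gradedPiece E K W (m + k) ≤ bracketSpan E K W m k := by
  set S := bracketSpan E K W m k
  obtain ⟨i, hi⟩ := Function.ne_iff.1 hk
  have hi' : (k i : ℂ) ≠ 0 := by exact_mod_cast hi
  have hE : ∀ x, E (m + k) x ∈ S := fun x => by
    have h := lie_mem_bracketSpan (W_mem_gradedPiece (E := E) (K := K) (W := W) m i)
      (E_mem_gradedPiece (E := E) (K := K) (W := W) k x)
    rw [hτ.lie_W_E] at h
    exact (S.smul_mem_iff hi').1 h
  have hKm : ∑ p, (m p : ℂ) • K (m + k) p ∈ S := by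
    obtain ⟨x, hx⟩ := exists_ne (0 : 𝔤)
    obtain ⟨y, hy⟩ : ∃ y, κ x y ≠ 0 := by
      by_contra! h
      exact hx (hτ.κ_nondeg x h)
    have h := lie_mem_bracketSpan (E_mem_gradedPiece (E := E) (K := K) (W := W) m x)
      (E_mem_gradedPiece (E := E) (K := K) (W := W) k y)
    rw [hτ.lie_E_E] at h
    exact (S.smul_mem_iff hy).1 ((S.add_mem_iff_right (hE _)).1 h)
  have hK : ∀ j, K (m + k) j ∈ S := fun j => by
    have h := lie_mem_bracketSpan (W_mem_gradedPiece (E := E) (K := K) (W := W) m i)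
      (K_mem_gradedPiece (E := E) (K := K) (W := W) k j)
    rw [hτ.lie_W_K] at h
    refine (S.smul_mem_iff hi').1 ((S.add_mem_iff_left ?_).1 h)
    split_ifs
    exacts [hKm, S.zero_mem]
  have hWW : ∀ a b, (k a : ℂ) • W (m + k) b - (m b : ℂ) • W (m + k) a ∈ S := fun a b => by
    have h := lie_mem_bracketSpan (W_mem_gradedPiece (E := E) (K := K) (W := W) m a)
      (W_mem_gradedPiece (E := E) (K := K) (W := W) k b)
    rw [hτ.lie_W_W] at h
    exact (S.add_mem_iff_left (S.smul_mem _ hKm)).1 h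
  obtain ⟨p, hp⟩ := Function.ne_iff.1 hmk
  have hp' : (k p : ℂ) - m p ≠ 0 := by
    rw [sub_ne_zero]
    exact_mod_cast hp.symm
  have hWp : W (m + k) p ∈ S := by
    refine (S.smul_mem_iff hp').1 ?_
    rw [sub_smul]
    exact hWW p p
  have hW : ∀ j, W (m + k) j ∈ S := fun j => by
    refine (S.smul_mem_iff hp').1 ?_
    have h := S.sub_mem (S.add_mem (hWW p j) (hWW j p))
      (S.smul_mem ((k j : ℂ) - m j) hWp)
    convert h using 1
    module
  exact gradedPiece_le hE hK hW

lemma gradedPiece_add_le_bracketSpan [Nontrivial 𝔤]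
    (hτ : IsFullToroidal n 𝔤 τ κ c₁ c₂ E K W) {m k : Fin n → ℤ} (hmk : m ≠ k) :
    gradedPiece E K W (m + k) ≤ bracketSpan E K W m k := by
  by_cases hk : k = 0
  · rw [add_comm]
    refine (gradedPiece_add_le_bracketSpan_of_ne_zero hτ hmk.symm ?_).trans
      (bracketSpan_le_swap k m)
    rintro rfl
    exact hmk hk.symm
  · exact gradedPiece_add_le_bracketSpan_of_ne_zero hτ hmk hk

end Generators

section Action

variable {κ : 𝔤 →ₗ[ℂ] 𝔤 →ₗ[ℂ] ℂ} {c₁ c₂ : ℂ}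
  {E : (Fin n → ℤ) → 𝔤 →ₗ[ℂ] τ} {K W : (Fin n → ℤ) → Fin n → τ}
  {B : Type} [CommRing B] [Algebra ℂ B]
  {V : Type} [AddCommGroup V] [Module ℂ V] [LieRingModule (B ⊗[ℂ] τ) V]

/-- `(S ⊗ b)·U = 0`. -/
def Kills (S : Submodule ℂ τ) (U : Submodule ℂ V) (b : B) : Prop :=
  ∀ X ∈ S, ∀ v ∈ U, ⁅b ⊗ₜ[ℂ] X, v⁆ = 0

lemma Kills.zero (S : Submodule ℂ τ) (U : Submodule ℂ V) : Kills S U (0 : B) := by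
  intro X _ v _
  rw [TensorProduct.zero_tmul, zero_lie]

lemma Kills.add {S : Submodule ℂ τ} {U : Submodule ℂ V} {a b : B} (ha : Kills S U a)
    (hb : Kills S U b) : Kills S U (a + b) := by
  intro X hX v hv
  rw [TensorProduct.add_tmul, add_lie, ha X hX v hv, hb X hX v hv, add_zero]

variable [LieModule ℂ (B ⊗[ℂ] τ) V]

lemma Kills.mul [Nontrivial 𝔤] (hτ : IsFullToroidal n 𝔤 τ κ c₁ c₂ E K W) {m k : Fin n → ℤ}
    (hmk : m ≠ k) {U : Submodule ℂ V} {a b : B} (ha : Kills (gradedPiece E K W m) U a)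
    (hb : Kills (gradedPiece E K W k) U b) : Kills (gradedPiece E K W (m + k)) U (a * b) := by
  intro Z hZ v hv
  replace hZ := gradedPiece_add_le_bracketSpan hτ hmk hZ
  induction hZ using Submodule.span_induction with
  | mem Z h =>
    obtain ⟨X, hX, Y, hY, rfl⟩ := h
    rw [← LieAlgebra.ExtendScalars.bracket_tmul, lie_lie, ha X hX v hv, hb Y hY v hv]
    simp
  | zero => rw [TensorProduct.tmul_zero, zero_lie]
  | add X Y _ _ hX hY => rw [TensorProduct.tmul_add, add_lie, hX, hY, add_zero]
  | smul c X _ hX => rw [TensorProduct.tmul_smul, smul_lie, hX, smul_zero]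

lemma lie_dOp_tmul (hτ : IsFullToroidal n 𝔤 τ κ c₁ c₂ E K W) {m : Fin n → ℤ} {X : τ}
    (hX : X ∈ gradedPiece E K W m) (a b : B) (i : Fin n) :
    ⁅a ⊗ₜ[ℂ] W 0 i, b ⊗ₜ[ℂ] X⁆ = (m i : ℂ) • ((a * b) ⊗ₜ[ℂ] X) := by
  rw [LieAlgebra.ExtendScalars.bracket_tmul, lie_W_zero hτ hX, TensorProduct.tmul_smul]

lemma lie_mem_weightSpace (hτ : IsFullToroidal n 𝔤 τ κ c₁ c₂ E K W) {m : Fin n → ℤ} {X : τ}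
    (hX : X ∈ gradedPiece E K W m) (b : B) {l : Fin n → ℂ} {v : V}
    (hv : v ∈ weightSpace (V := V) (dOp B W) l) :
    ⁅b ⊗ₜ[ℂ] X, v⁆ ∈ weightSpace (V := V) (dOp B W) (fun i => l i + m i) := by
  intro i
  have hvi : ⁅dOp B W i, v⁆ = l i • v := hv i
  rw [leibniz_lie, hvi, dOp, lie_dOp_tmul hτ hX, one_mul, smul_lie, lie_smul, add_smul, add_comm]

/-- The action map `B → Hom(S, Hom(U, U'))` when `(S ⊗ B)·U ⊆ U'`. -/
lemma exists_linearMap_eq_zero_iff_kills (S : Submodule ℂ τ) (U U' : Submodule ℂ V)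
    (h : ∀ b : B, ∀ X ∈ S, ∀ v ∈ U, ⁅b ⊗ₜ[ℂ] X, v⁆ ∈ U') :
    ∃ Φ : B →ₗ[ℂ] S →ₗ[ℂ] U →ₗ[ℂ] U', ∀ b, Φ b = 0 ↔ Kills S U b := by
  let f : B → S → U →ₗ[ℂ] U' := fun b X =>
    { toFun := fun v => ⟨⁅b ⊗ₜ[ℂ] (X : τ), (v : V)⁆, h b X X.2 v v.2⟩
      map_add' := fun v w => Subtype.ext (lie_add _ _ _)
      map_smul' := fun c v => Subtype.ext (lie_smul _ _ _) }
  refine ⟨LinearMap.mk₂ ℂ f ?_ ?_ ?_ ?_, fun b => ⟨fun hb X hX v hv => ?_, fun hb => ?_⟩⟩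
  · intro a b X
    refine LinearMap.ext fun v => Subtype.ext ?_
    change ⁅(a + b) ⊗ₜ[ℂ] (X : τ), (v : V)⁆ =
      ⁅a ⊗ₜ[ℂ] (X : τ), (v : V)⁆ + ⁅b ⊗ₜ[ℂ] (X : τ), (v : V)⁆
    rw [TensorProduct.add_tmul, add_lie]
  · intro c b X
    refine LinearMap.ext fun v => Subtype.ext ?_
    change ⁅(c • b) ⊗ₜ[ℂ] (X : τ), (v : V)⁆ = c • ⁅b ⊗ₜ[ℂ] (X : τ), (v : V)⁆
    rw [← TensorProduct.smul_tmul', smul_lie]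
  · intro b X Y
    refine LinearMap.ext fun v => Subtype.ext ?_
    change ⁅b ⊗ₜ[ℂ] ((X : τ) + Y), (v : V)⁆ =
      ⁅b ⊗ₜ[ℂ] (X : τ), (v : V)⁆ + ⁅b ⊗ₜ[ℂ] (Y : τ), (v : V)⁆
    rw [TensorProduct.tmul_add, add_lie]
  · intro c b X
    refine LinearMap.ext fun v => Subtype.ext ?_
    change ⁅b ⊗ₜ[ℂ] (c • (X : τ)), (v : V)⁆ = c • ⁅b ⊗ₜ[ℂ] (X : τ), (v : V)⁆
    rw [TensorProduct.tmul_smul, smul_lie]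
  · exact congrArg Subtype.val (LinearMap.congr_fun (LinearMap.congr_fun hb ⟨X, hX⟩) ⟨v, hv⟩)
  · exact LinearMap.ext fun X => LinearMap.ext fun v => Subtype.ext (hb X X.2 v v.2)

lemma finrank_quotient_le_of_mem_iff_kills (S : Submodule ℂ τ) (U U' : Submodule ℂ V)
    [FiniteDimensional ℂ S] [FiniteDimensional ℂ U] [FiniteDimensional ℂ U']
    (h : ∀ b : B, ∀ X ∈ S, ∀ v ∈ U, ⁅b ⊗ₜ[ℂ] X, v⁆ ∈ U') (P : Ideal B)
    (hP : ∀ b, b ∈ P ↔ Kills S U b) :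
    FiniteDimensional ℂ (B ⧸ P) ∧ Module.finrank ℂ (B ⧸ P) ≤
      Module.finrank ℂ S * (Module.finrank ℂ U * Module.finrank ℂ U') := by
  obtain ⟨Φ, hΦ⟩ := exists_linearMap_eq_zero_iff_kills S U U' h
  have hker : ∀ b, b ∈ P ↔ Φ b = 0 := fun b => (hP b).trans (hΦ b).symm

  have key := @finrank_quotient_le_of_mem_iff B _ _ (S →ₗ[ℂ] U →ₗ[ℂ] U')
    LinearMap.addCommGroup _ _ P Φ hker
  rwa [Module.finrank_linearMap, Module.finrank_linearMap] at key

/-- For `m ≠ 0`, the elements `b` with `(τ_m ⊗ b)·V_l = 0` form an ideal, whose codimension is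
bounded independently of `m`. -/
lemma exists_ideal_kills [FiniteDimensional ℂ 𝔤] (hτ : IsFullToroidal n 𝔤 τ κ c₁ c₂ E K W)
    (hHC : IsHarishChandra (V := V) (dOp B W)) {N : ℕ}
    (hN : ∀ l, Module.finrank ℂ (weightSpace (V := V) (dOp B W) l) ≤ N) (l : Fin n → ℂ)
    {m : Fin n → ℤ} (hm : m ≠ 0) :
    ∃ P : Ideal B,
      (∀ b, b ∈ P ↔ Kills (gradedPiece E K W m) (weightSpace (V := V) (dOp B W) l) b) ∧
      FiniteDimensional ℂ (B ⧸ P) ∧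
      Module.finrank ℂ (B ⧸ P) ≤ (Module.finrank ℂ 𝔤 + (n + n)) * (N * N) := by
  obtain ⟨i, hi⟩ := Function.ne_iff.1 hm
  have hi' : (m i : ℂ) ≠ 0 := by exact_mod_cast hi
  let P : Ideal B :=
    { carrier := {b | Kills (gradedPiece E K W m) (weightSpace (V := V) (dOp B W) l) b}
      add_mem' := fun ha hb => ha.add hb
      zero_mem' := Kills.zero _ _
      smul_mem' := by
        intro a b hb X hX v hv
        have hv' : ⁅a ⊗ₜ[ℂ] W 0 i, v⁆ ∈ weightSpace (V := V) (dOp B W) l := by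
          simpa using lie_mem_weightSpace hτ (W_mem_gradedPiece 0 i) a hv
        have h : ⁅⁅a ⊗ₜ[ℂ] W 0 i, b ⊗ₜ[ℂ] X⁆, v⁆ = 0 := by
          rw [lie_lie, hb X hX v hv, hb X hX _ hv', lie_zero, sub_zero]
        rw [lie_dOp_tmul hτ hX, smul_lie] at h
        exact (smul_eq_zero.1 h).resolve_left hi' }
  obtain ⟨hfd, hrank⟩ := gradedPiece_finrank_le (E := E) (K := K) (W := W) m
  have := hHC.2 l
  have := hHC.2 fun i => l i + m i
  obtain ⟨hPfin, hPrank⟩ := finrank_quotient_le_of_mem_iff_kills (gradedPiece E K W m)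
    (weightSpace (V := V) (dOp B W) l) (weightSpace (V := V) (dOp B W) fun i => l i + m i)
    (fun b _ hX _ hv => lie_mem_weightSpace hτ hX b hv) P (fun b => Iff.rfl)
  exact ⟨P, fun b => Iff.rfl, hPfin,
    hPrank.trans (Nat.mul_le_mul hrank (Nat.mul_le_mul (hN _) (hN _)))⟩

/-- The vectors annihilated by `τ ⊗ J`. -/
def annihilatedBy (τ : Type) [LieRing τ] [LieAlgebra ℂ τ] (V : Type) [AddCommGroup V]
    [Module ℂ V] [LieRingModule (B ⊗[ℂ] τ) V] [LieModule ℂ (B ⊗[ℂ] τ) V] (J : Ideal B) :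
    LieSubmodule ℂ (B ⊗[ℂ] τ) V where
  carrier := {v | ∀ X : τ, ∀ a ∈ J, ⁅a ⊗ₜ[ℂ] X, v⁆ = 0}
  add_mem' := by
    intro v w hv hw X a ha
    rw [lie_add, hv X a ha, hw X a ha, add_zero]
  zero_mem' := by
    intro X a _
    rw [lie_zero]
  smul_mem' := by
    intro c v hv X a ha
    rw [lie_smul, hv X a ha, smul_zero]
  lie_mem := by
    intro Y v hv X a ha
    induction Y using TensorProduct.induction_on with
    | zero => rw [zero_lie, lie_zero]
    | tmul b Y =>
      rw [leibniz_lie, LieAlgebra.ExtendScalars.bracket_tmul,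
        hv _ _ (Ideal.mul_mem_right b J ha), hv X a ha, lie_zero, add_zero]
    | add Y Z hY hZ => rw [add_lie, lie_add, hY, hZ, add_zero]

end Action

theorem statement_7
    (n : ℕ) (hn : 3 ≤ n)
    (𝔤 : Type) [LieRing 𝔤] [LieAlgebra ℂ 𝔤] [LieAlgebra.IsSimple ℂ 𝔤]
    [FiniteDimensional ℂ 𝔤]
    (τ : Type) [LieRing τ] [LieAlgebra ℂ τ]
    (κ : 𝔤 →ₗ[ℂ] 𝔤 →ₗ[ℂ] ℂ) (c₁ c₂ : ℂ)
    (E : (Fin n → ℤ) → 𝔤 →ₗ[ℂ] τ) (K W : (Fin n → ℤ) → Fin n → τ)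
    (hτ : IsFullToroidal n 𝔤 τ κ c₁ c₂ E K W)
    (B : Type) [CommRing B] [Algebra ℂ B] [Nontrivial B]
    (hB : Algebra.FiniteType ℂ B)
    (V : Type) [AddCommGroup V] [Module ℂ V]
    [LieRingModule (B ⊗[ℂ] τ) V] [LieModule ℂ (B ⊗[ℂ] τ) V]
    (hirr : LieModule.IsIrreducible ℂ (B ⊗[ℂ] τ) V)
    (hcusp : IsCuspidal (V := V) (dOp B W))
 :
    ∃ J : Ideal B, FiniteDimensional ℂ (B ⧸ J) ∧ annTensor τ B J V := by
  classical
  obtain ⟨hHC, N, hN⟩ := hcusp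
  have : Nontrivial 𝔤 := by
    by_contra h
    rw [not_nontrivial_iff_subsingleton] at h
    exact LieAlgebra.IsSimple.non_abelian ℂ (L := 𝔤) ⟨fun x y => Subsingleton.elim _ _⟩
  have : IsNoetherianRing B := Algebra.FiniteType.isNoetherianRing ℂ B
  obtain ⟨l, v, hv, hv0⟩ : ∃ l, ∃ v ∈ weightSpace (V := V) (dOp B W) l, v ≠ 0 := by
    by_contra! h
    have hbot : (⨆ l : Fin n → ℂ, weightSpace (V := V) (dOp B W) l) = ⊥ :=
      iSup_eq_bot.2 fun l => (Submodule.eq_bot_iff _).2 (h l)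
    have hV : ∀ v : V, v = 0 := fun v =>
      (Submodule.mem_bot ℂ).1 (hbot ▸ hHC.1 ▸ Submodule.mem_top)
    refine bot_ne_top (α := LieSubmodule ℂ (B ⊗[ℂ] τ) V) ?_
    ext v
    simp [hV v]
  set U := weightSpace (V := V) (dOp B W) l
  set C := (Module.finrank ℂ 𝔤 + (n + n)) * (N * N)
  choose! P hPmem hPfin hPrank using
    fun (m : Fin n → ℤ) (hm : m ≠ 0) => exists_ideal_kills hτ hHC hN l hm
  let s : Finset (Fin n × ℤ) := Finset.univ ×ˢ {1, -1, 2, -2}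
  let J : Ideal B := s.inf fun p => P (Pi.single p.1 p.2)
  have hs : ∀ p ∈ s, (Pi.single p.1 p.2 : Fin n → ℤ) ≠ 0 := by
    intro p hp
    rw [Ne, Pi.single_eq_zero_iff]
    intro h0
    simp [s, h0] at hp
  have hJ : FiniteDimensional ℂ (B ⧸ J) :=
    finiteDimensional_quotient_finset_inf s _ fun p hp => hPfin _ (hs p hp)
  have kills_mul : ∀ m k : Fin n → ℤ, m ≠ k → ∀ I₁ I₂ : Ideal B,
      (∀ b ∈ I₁, Kills (gradedPiece E K W m) U b) →
      (∀ b ∈ I₂, Kills (gradedPiece E K W k) U b) →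
      ∀ b ∈ I₁ * I₂, Kills (gradedPiece E K W (m + k)) U b := by
    intro m k hmk I₁ I₂ h₁ h₂ b hb
    refine Submodule.mul_induction_on hb (fun a ha b hb => ?_) (fun a b ha hb => ha.add hb)
    exact (h₁ a ha).mul hτ hmk (h₂ b hb)
  have hpow : ∀ m : Fin n → ℤ, ∃ r : ℕ, ∀ b ∈ J ^ r, Kills (gradedPiece E K W m) U b := by
    refine mem_of_add_mem_of_ne (by omega)
      {m | ∃ r : ℕ, ∀ b ∈ J ^ r, Kills (gradedPiece E K W m) U b} ?_ ?_
    · rintro m ⟨r₁, h₁⟩ k ⟨r₂, h₂⟩ hmk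
      refine ⟨r₁ + r₂, ?_⟩
      rw [pow_add]
      exact kills_mul m k hmk _ _ h₁ h₂
    · intro i c hc
      have hp : (i, c) ∈ s := Finset.mem_product.2 ⟨Finset.mem_univ i, hc⟩
      refine ⟨1, fun b hb => (hPmem _ (hs _ hp) b).1 ?_⟩
      rw [pow_one] at hb
      exact Finset.inf_le (f := fun p : Fin n × ℤ => P (Pi.single p.1 p.2)) hp hb
  have hne : ∀ m : Fin n → ℤ, m ≠ 0 → ∀ b ∈ J ^ C, Kills (gradedPiece E K W m) U b := by
    intro m hm b hb
    obtain ⟨r, hr⟩ := hpow m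
    have := hPfin m hm
    exact (hPmem m hm b).1
      (pow_le_of_finrank_quotient_le (hPrank m hm) (fun a ha => (hPmem m hm a).2 (hr a ha)) hb)
  have hall : ∀ m : Fin n → ℤ, ∀ b ∈ J ^ (C + C), Kills (gradedPiece E K W m) U b := by
    intro m b hb
    by_cases hm : m = 0
    · let i : Fin n := ⟨0, by omega⟩
      have hi : (Pi.single i 1 : Fin n → ℤ) ≠ 0 := by simp
      have hsum : m = Pi.single i 1 + -Pi.single i 1 := by rw [hm, add_neg_cancel]
      rw [hsum]
      rw [pow_add] at hb
      refine kills_mul _ _ ?_ _ _ (hne _ hi) (hne _ (neg_ne_zero.2 hi)) b hb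
      exact fun h => hi (self_eq_neg.1 h)
    · exact hne m hm b (Ideal.pow_le_pow_right (Nat.le_add_right C C) hb)
  refine ⟨J ^ (C + C), finiteDimensional_quotient_pow J _, ?_⟩
  have hvmem : v ∈ annihilatedBy τ V (J ^ (C + C)) := by
    intro X a ha
    have hX : X ∈ ⨆ m, gradedPiece E K W m := by
      rw [iSup_gradedPiece_eq_top hτ]
      exact Submodule.mem_top
    induction hX using Submodule.iSup_induction' with
    | mem m X hX => exact hall m a ha X hX v hv
    | zero => rw [TensorProduct.tmul_zero, zero_lie]
    | add X Y _ _ hX hY => rw [TensorProduct.tmul_add, add_lie, hX, hY, add_zero]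
  have htop : annihilatedBy τ V (J ^ (C + C)) = ⊤ := by
    refine (hirr.eq_bot_or_eq_top _).resolve_left fun h => hv0 ?_
    rw [h] at hvmem
    exact (LieSubmodule.mem_bot v).1 hvmem
  intro X a ha w
  have hw : w ∈ annihilatedBy τ V (J ^ (C + C)) := htop ▸ LieSubmodule.mem_top w
  exact hw X a ha

end MT
end

section
/- Let V be an irreducible cuspidal Harish-Chandra module over τ(B) with V = ⊕_{m∈ℤ^n} V_{λ+m}, and fix m ∈ ℤ^n with V_{λ+m} ≠ 0. For j ∈ ℤ ∖ {0}, set I_j = { a ∈ B : (t_1^j d_i ⊗ a)·V_{λ+m} = 0 for all 1 ≤ i ≤ n }. Then I_j is an ideal of B of finite codimension (dim_ℂ B/I_j < ∞). -/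
open scoped TensorProduct

namespace MT

variable {n : ℕ} {𝔤 : Type} [LieRing 𝔤] [LieAlgebra ℂ 𝔤]
variable {τ : Type} [LieRing τ] [LieAlgebra ℂ τ]

/-- An operator that is an eigenvector for the adjoint action of `d` shifts weight spaces. -/
lemma lie_mem_weightSpace_s8 {L V : Type*} [LieRing L] [LieAlgebra ℂ L] [AddCommGroup V]
    [Module ℂ V] [LieRingModule L V] [LieModule ℂ L V] {d : Fin n → L} {l s : Fin n → ℂ}
    {x : L} (hx : ∀ i, ⁅d i, x⁆ = s i • x) {v : V} (hv : v ∈ weightSpace d l) :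
    ⁅x, v⁆ ∈ weightSpace (V := V) d (fun i => l i + s i) := by
  intro i
  rw [leibniz_lie, hx i, hv i, smul_lie, lie_smul, add_smul, add_comm]

section Witt

variable {κ : 𝔤 →ₗ[ℂ] 𝔤 →ₗ[ℂ] ℂ} {c₁ c₂ : ℂ}
  {E : (Fin n → ℤ) → 𝔤 →ₗ[ℂ] τ} {K W : (Fin n → ℤ) → Fin n → τ}

lemma IsFullToroidal.lie_W_zero_W (hτ : IsFullToroidal n 𝔤 τ κ c₁ c₂ E K W)
    (k : Fin n → ℤ) (i p : Fin n) : ⁅W 0 p, W k i⁆ = (k p : ℂ) • W k i := by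
  rw [hτ.lie_W_W]
  simp

lemma IsFullToroidal.lie_tmul_W_zero_W (hτ : IsFullToroidal n 𝔤 τ κ c₁ c₂ E K W)
    {B : Type} [CommRing B] [Algebra ℂ B] (a b : B) (k : Fin n → ℤ) (i p : Fin n) :
    ⁅b ⊗ₜ[ℂ] W 0 p, a ⊗ₜ[ℂ] W k i⁆ = (k p : ℂ) • ((b * a) ⊗ₜ[ℂ] W k i) := by
  rw [LieAlgebra.ExtendScalars.bracket_tmul, hτ.lie_W_zero_W, TensorProduct.tmul_smul]

lemma IsFullToroidal.lie_dOp_tmul_W (hτ : IsFullToroidal n 𝔤 τ κ c₁ c₂ E K W)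
    {B : Type} [CommRing B] [Algebra ℂ B] (a : B) (k : Fin n → ℤ) (i p : Fin n) :
    ⁅dOp B W p, a ⊗ₜ[ℂ] W k i⁆ = (k p : ℂ) • (a ⊗ₜ[ℂ] W k i) := by
  rw [dOp, hτ.lie_tmul_W_zero_W, one_mul]

end Witt

theorem statement_8
    (n : ℕ) (hn : 3 ≤ n)
    (𝔤 : Type) [LieRing 𝔤] [LieAlgebra ℂ 𝔤] [LieAlgebra.IsSimple ℂ 𝔤]
    [FiniteDimensional ℂ 𝔤]
    (τ : Type) [LieRing τ] [LieAlgebra ℂ τ]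
    (κ : 𝔤 →ₗ[ℂ] 𝔤 →ₗ[ℂ] ℂ) (c₁ c₂ : ℂ)
    (E : (Fin n → ℤ) → 𝔤 →ₗ[ℂ] τ) (K W : (Fin n → ℤ) → Fin n → τ)
    (hτ : IsFullToroidal n 𝔤 τ κ c₁ c₂ E K W)
    (B : Type) [CommRing B] [Algebra ℂ B] [Nontrivial B]
    (hB : Algebra.FiniteType ℂ B)
    (V : Type) [AddCommGroup V] [Module ℂ V]
    [LieRingModule (B ⊗[ℂ] τ) V] [LieModule ℂ (B ⊗[ℂ] τ) V]
    (hirr : LieModule.IsIrreducible ℂ (B ⊗[ℂ] τ) V)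
    (hcusp : IsCuspidal (V := V) (dOp B W))
    (l : Fin n → ℂ) (m : Fin n → ℤ)
    (hwt : weightSpace (V := V) (dOp B W) (fun i => l i + (m i : ℂ)) ≠ ⊥)
    (j : ℤ) (hj : j ≠ 0) :
    ∃ I : Ideal B,
      (∀ a : B, a ∈ I ↔ ∀ i : Fin n,
        ∀ v ∈ weightSpace (V := V) (dOp B W) (fun i => l i + (m i : ℂ)),
          ⁅a ⊗ₜ[ℂ] W (Pi.single (⟨0, by omega⟩ : Fin n) j) i, v⁆ = 0) ∧
      FiniteDimensional ℂ (B ⧸ I) := by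
  set p : Fin n := ⟨0, by omega⟩
  set k : Fin n → ℤ := Pi.single p j
  set U := weightSpace (V := V) (dOp B W) (fun i => l i + (m i : ℂ))
  have hkp : (k p : ℂ) ≠ 0 := by simpa [k] using hj
  have hU : ∀ (b : B), ∀ v ∈ U, ⁅b ⊗ₜ[ℂ] W 0 p, v⁆ ∈ U := by
    intro b v hv
    simpa using lie_mem_weightSpace_s8 (fun q => hτ.lie_dOp_tmul_W b 0 p q) hv
  let I : Ideal B :=
    { carrier := {a | ∀ i, ∀ v ∈ U, ⁅a ⊗ₜ[ℂ] W k i, v⁆ = 0}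
      add_mem' := by
        intro a b ha hb i v hv
        rw [TensorProduct.add_tmul, add_lie, ha i v hv, hb i v hv, add_zero]
      zero_mem' := by
        intro i v _
        rw [TensorProduct.zero_tmul, zero_lie]
      smul_mem' := by
        intro b a ha i v hv
        have h : ⁅⁅b ⊗ₜ[ℂ] W 0 p, a ⊗ₜ[ℂ] W k i⁆, v⁆ = 0 := by
          rw [lie_lie, ha i v hv, lie_zero, ha i _ (hU b v hv), sub_zero]
        rw [hτ.lie_tmul_W_zero_W, smul_lie] at h
        exact (smul_eq_zero.mp h).resolve_left hkp }
  refine ⟨I, fun a => Iff.rfl, ?_⟩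
  let U' := weightSpace (V := V) (dOp B W) (fun i => l i + (m i : ℂ) + (k i : ℂ))
  have : FiniteDimensional ℂ U := hcusp.1.2 _
  have : FiniteDimensional ℂ U' := hcusp.1.2 _
  let f : B →ₗ[ℂ] (Fin n → U →ₗ[ℂ] U') :=
    { toFun := fun a i =>
        { toFun := fun v =>
            ⟨⁅a ⊗ₜ[ℂ] W k i, (v : V)⁆,
              lie_mem_weightSpace_s8 (fun q => hτ.lie_dOp_tmul_W a k i q) v.2⟩
          map_add' := fun v w => Subtype.ext (lie_add _ _ _)
          map_smul' := fun c v => Subtype.ext (lie_smul _ _ _) }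
      map_add' := by
        intro a b
        ext i v
        simp [TensorProduct.add_tmul]
      map_smul' := by
        intro c a
        ext i v
        simp [← TensorProduct.smul_tmul'] }
  have hf : LinearMap.ker f ≤ LinearMap.ker (Ideal.Quotient.mkₐ ℂ I).toLinearMap := by
    intro a ha
    have ha' : a ∈ I := fun i v hv =>
      congrArg Subtype.val (LinearMap.congr_fun (congrFun ha i) ⟨v, hv⟩)
    simpa using Ideal.Quotient.eq_zero_iff_mem.mpr ha'
  have : FiniteDimensional ℂ (B ⧸ LinearMap.ker f) :=
    Module.Finite.equiv f.quotKerEquivRange.symm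
  refine Module.Finite.of_surjective ((LinearMap.ker f).liftQ _ hf) ?_
  intro x
  obtain ⟨a, rfl⟩ := Ideal.Quotient.mk_surjective x
  exact ⟨Submodule.Quotient.mk a, rfl⟩

end MT
end

section
/- With V, λ, m, and the ideals I_j = { a ∈ B : (t_1^j d_i ⊗ a)·V_{λ+m} = 0 for all 1 ≤ i ≤ n } as given (V an irreducible cuspidal Harish-Chandra module over τ(B) and V_{λ+m} ≠ 0), one has I_1^j I_2 ⊆ I_{j+2} for all integers j ≥ 1, where I_1^j I_2 denotes the product of ideals. -/
open scoped TensorProduct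

namespace MT

variable {n : ℕ} {𝔤 : Type} [LieRing 𝔤] [LieAlgebra ℂ 𝔤]
variable {τ : Type} [LieRing τ] [LieAlgebra ℂ τ]

/-- Brackets of the `t₁`-graded vector fields: the cocycle term vanishes by the Kähler relation. -/
theorem IsFullToroidal.lie_W_single_W_single
    {κ : 𝔤 →ₗ[ℂ] 𝔤 →ₗ[ℂ] ℂ} {c₁ c₂ : ℂ}
    {E : (Fin n → ℤ) → 𝔤 →ₗ[ℂ] τ} {K W : (Fin n → ℤ) → Fin n → τ}
    (hτ : IsFullToroidal n 𝔤 τ κ c₁ c₂ E K W) (o i : Fin n) {k : ℤ} (hk : 1 + k ≠ 0) :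
    ⁅W (Pi.single o 1) o, W (Pi.single o k) i⁆
      = ((k : ℂ) - if i = o then 1 else 0) • W (Pi.single o (1 + k)) i := by
  have hadd : (Pi.single o 1 + Pi.single o k : Fin n → ℤ) = Pi.single o (1 + k) := by
    ext p
    by_cases hp : p = o
    · subst hp
      simp
    · simp [hp]
  have hsum : ∀ (a b : ℤ), ∑ p, ((Pi.single o a : Fin n → ℤ) p : ℂ) • K (Pi.single o b) p
      = (a : ℂ) • K (Pi.single o b) o := by
    intro a b
    rw [Finset.sum_eq_single o]
    · simp
    · intro p _ hp
      simp [hp]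
    · simp
  have hK : K (Pi.single o (1 + k)) o = 0 := by
    have h := hτ.K_rel (Pi.single o (1 + k))
    rw [hsum] at h
    exact (smul_eq_zero.mp h).resolve_left (by exact_mod_cast hk)
  rw [hτ.lie_W_W, hadd, hsum, hK, smul_zero, smul_zero, add_zero]
  by_cases hi : i = o
  · subst hi
    simp [sub_smul]
  · simp [hi]

/-- If `t₁ d_o ⊗ a` and `t₁^k d_i ⊗ b` kill a vector, so does `t₁^(k+1) d_i ⊗ ab`. -/
theorem IsFullToroidal.lie_mul_tmul_W_single_eq_zero
    {κ : 𝔤 →ₗ[ℂ] 𝔤 →ₗ[ℂ] ℂ} {c₁ c₂ : ℂ}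
    {E : (Fin n → ℤ) → 𝔤 →ₗ[ℂ] τ} {K W : (Fin n → ℤ) → Fin n → τ}
    (hτ : IsFullToroidal n 𝔤 τ κ c₁ c₂ E K W)
    {B V : Type} [CommRing B] [Algebra ℂ B] [AddCommGroup V] [Module ℂ V]
    [LieRingModule (B ⊗[ℂ] τ) V] [LieModule ℂ (B ⊗[ℂ] τ) V]
    (o i : Fin n) {k : ℤ} (hk : 2 ≤ k) {a b : B} {v : V}
    (ha : ⁅a ⊗ₜ[ℂ] W (Pi.single o 1) o, v⁆ = 0)
    (hb : ⁅b ⊗ₜ[ℂ] W (Pi.single o k) i, v⁆ = 0) :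
    ⁅(a * b) ⊗ₜ[ℂ] W (Pi.single o (1 + k)) i, v⁆ = 0 := by
  have h : ⁅⁅a ⊗ₜ[ℂ] W (Pi.single o 1) o, b ⊗ₜ[ℂ] W (Pi.single o k) i⁆, v⁆ = 0 := by
    rw [lie_lie, ha, hb, lie_zero, lie_zero, sub_zero]
  rw [LieAlgebra.ExtendScalars.bracket_tmul, hτ.lie_W_single_W_single o i (by omega),
    TensorProduct.tmul_smul, smul_lie] at h
  refine (smul_eq_zero.mp h).resolve_left ?_
  split_ifs
  · exact_mod_cast (by omega : k - 1 ≠ 0)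
  · exact_mod_cast (by omega : k - 0 ≠ 0)

theorem statement_9
    (n : ℕ) (hn : 3 ≤ n)
    (𝔤 : Type) [LieRing 𝔤] [LieAlgebra ℂ 𝔤] [LieAlgebra.IsSimple ℂ 𝔤]
    [FiniteDimensional ℂ 𝔤]
    (τ : Type) [LieRing τ] [LieAlgebra ℂ τ]
    (κ : 𝔤 →ₗ[ℂ] 𝔤 →ₗ[ℂ] ℂ) (c₁ c₂ : ℂ)
    (E : (Fin n → ℤ) → 𝔤 →ₗ[ℂ] τ) (K W : (Fin n → ℤ) → Fin n → τ)
    (hτ : IsFullToroidal n 𝔤 τ κ c₁ c₂ E K W)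
    (B : Type) [CommRing B] [Algebra ℂ B] [Nontrivial B]
    (hB : Algebra.FiniteType ℂ B)
    (V : Type) [AddCommGroup V] [Module ℂ V]
    [LieRingModule (B ⊗[ℂ] τ) V] [LieModule ℂ (B ⊗[ℂ] τ) V]
    (hirr : LieModule.IsIrreducible ℂ (B ⊗[ℂ] τ) V)
    (hcusp : IsCuspidal (V := V) (dOp B W))
    (l : Fin n → ℂ) (m : Fin n → ℤ)
    (hwt : weightSpace (V := V) (dOp B W) (fun i => l i + (m i : ℂ)) ≠ ⊥)
    (j : ℕ) (hj : 1 ≤ j)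
    (I₁ I₂ J : Ideal B)
    (hI₁ : (I₁ : Set B) = {a : B | ∀ i : Fin n,
      ∀ v ∈ weightSpace (V := V) (dOp B W) (fun i => l i + (m i : ℂ)),
        ⁅a ⊗ₜ[ℂ] W (Pi.single (⟨0, by omega⟩ : Fin n) (1 : ℤ)) i, v⁆ = 0})
    (hI₂ : (I₂ : Set B) = {a : B | ∀ i : Fin n,
      ∀ v ∈ weightSpace (V := V) (dOp B W) (fun i => l i + (m i : ℂ)),
        ⁅a ⊗ₜ[ℂ] W (Pi.single (⟨0, by omega⟩ : Fin n) (2 : ℤ)) i, v⁆ = 0})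
    (hJ : (J : Set B) = {a : B | ∀ i : Fin n,
      ∀ v ∈ weightSpace (V := V) (dOp B W) (fun i => l i + (m i : ℂ)),
        ⁅a ⊗ₜ[ℂ] W (Pi.single (⟨0, by omega⟩ : Fin n) ((j : ℤ) + 2)) i, v⁆ = 0}) :
    I₁ ^ j * I₂ ≤ J := by
  have key : ∀ r : ℕ, ∀ c ∈ I₁ ^ r * I₂, ∀ i : Fin n,
      ∀ v ∈ weightSpace (V := V) (dOp B W) (fun i => l i + (m i : ℂ)),
        ⁅c ⊗ₜ[ℂ] W (Pi.single (⟨0, by omega⟩ : Fin n) ((r : ℤ) + 2)) i, v⁆ = 0 := by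
    intro r
    induction r with
    | zero =>
      intro c hc
      rw [pow_zero, one_mul, ← SetLike.mem_coe, hI₂] at hc
      simpa using hc
    | succ r ih =>
      intro c hc i v hv
      rw [pow_succ', mul_assoc] at hc
      induction hc using Submodule.mul_induction_on' with
      | mem_mul_mem a ha b hb =>
        rw [← SetLike.mem_coe, hI₁] at ha
        have h := hτ.lie_mul_tmul_W_single_eq_zero _ i (by omega) (ha _ v hv) (ih b hb i v hv)
        rwa [show (1 : ℤ) + ((r : ℤ) + 2) = ((r + 1 : ℕ) : ℤ) + 2 by push_cast; ring] at h
      | add x _ y _ hx hy =>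
        rw [TensorProduct.add_tmul, add_lie, hx, hy, add_zero]
  intro c hc
  rw [← SetLike.mem_coe, hJ]
  exact key j c hc

end MT
end
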